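/- Let u(x,t) = u_0(x − t) with u_0 : ℝ → ℝ of class C^{2k+2}, let u_h be a DG solution on [0,T] with the Dirichlet inflow flux u_h(x_{1/2}^-,t) = u_0(−t), and suppose the initial value is u_h(·,0) = u_I^k(·,0) on Ω. Then there is a constant C depending only on k and the quasi-uniformity constant c such that for all t ∈ [0,T], | (1/(2π)) ∫_0^{2π} (u − u_h)(x,t) dx | ≤ C (h^{1/2} + t²) h^{2k+1/2} M_{2k+2}. -/

import Mathlib

open MeasureTheory intervalIntegral

/-- Legendre polynomial of degree `m` via the Rodrigues formula. -/
noncomputable def legendreP (m : ℕ) : ℝ → ℝ :=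
  fun s => (1 / ((2:ℝ) ^ m * (Nat.factorial m : ℝ))) *
    iteratedDeriv m (fun t : ℝ => (t ^ 2 - 1) ^ m) s

/-- Legendre polynomial rescaled to the cell `(a, b)`. -/
noncomputable def legendreCell (m : ℕ) (a b : ℝ) : ℝ → ℝ :=
  fun x => legendreP m ((2 * x - (a + b)) / (b - a))

/-- `P` is the Gauss–Radau projection (onto polynomials of degree ≤ k on `(a,b)`) of `u`. -/
def IsGRProj (k : ℕ) (a b : ℝ) (u : ℝ → ℝ) (P : Polynomial ℝ) : Prop :=
  P.natDegree ≤ k ∧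
  (∀ v : Polynomial ℝ, v.natDegree + 1 ≤ k →
    (∫ x in a..b, P.eval x * v.eval x) = ∫ x in a..b, u x * v.eval x) ∧
  P.eval b = u b

/-- The scaled primitive `(D⁻¹ v)(x) = (2/(b-a)) ∫_a^x v`. -/
noncomputable def Dinv (a b : ℝ) (v : ℝ → ℝ) : ℝ → ℝ :=
  fun x => (2 / (b - a)) * ∫ t in a..x, v t

/-- `F` is the sequence of correction polynomials on the cell `(a,b)`:
`F 1 = P_h^-(D⁻¹ L_k)` and `F i = -P_h^-(D⁻¹ F (i-1))` for `i ≥ 2`. -/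
def IsFSeq (k : ℕ) (a b : ℝ) (F : ℕ → Polynomial ℝ) : Prop :=
  IsGRProj k a b (Dinv a b (legendreCell k a b)) (F 1) ∧
  ∀ i, 2 ≤ i → IsGRProj k a b (Dinv a b (fun x => (F (i-1)).eval x)) (-(F i))

/-- The `m`-th Radau coefficient of `w` on the cell `(a,b)`. -/
noncomputable def radauCoeff (a b : ℝ) (w : ℝ → ℝ) (m : ℕ) : ℝ :=
  w b - (1 / (b - a)) *
    ∫ x in a..b, w x * ∑ l ∈ Finset.range m, (2 * (l:ℝ) + 1) * legendreCell l a b x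

/-- `G_i(t) = (d/dt)^i u_{j,k+1}(t)` for `u(x,t) = u0(x - t)` on the cell `(a,b)`. -/
noncomputable def Gfun (k : ℕ) (a b : ℝ) (u0 : ℝ → ℝ) (i : ℕ) (t : ℝ) : ℝ :=
  iteratedDeriv i (fun s => radauCoeff a b (fun y => u0 (y - s)) (k + 1)) t

/-- `w_i(x,t) = (h_j/2)^i G_i(t) F_i(x)` on the cell `(a,b)`. -/
noncomputable def wFun (k : ℕ) (a b : ℝ) (u0 : ℝ → ℝ) (F : ℕ → Polynomial ℝ)
    (i : ℕ) (y t : ℝ) : ℝ :=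
  ((b - a) / 2) ^ i * Gfun k a b u0 i t * (F i).eval y

/-- `w^l = Σ_{i=1}^l w_i` on the cell `(a,b)`. -/
noncomputable def wSum (k : ℕ) (a b : ℝ) (u0 : ℝ → ℝ) (F : ℕ → Polynomial ℝ)
    (l : ℕ) (y t : ℝ) : ℝ :=
  ∑ i ∈ Finset.Icc 1 l, wFun k a b u0 F i y t

/-- The interpolation function `u_I^l = P_h^- u - w^l` on the cell `(a,b)`;
here `P t` is the Gauss–Radau projection of `u(·,t)`. -/
noncomputable def uIl (k : ℕ) (a b : ℝ) (u0 : ℝ → ℝ) (P : ℝ → Polynomial ℝ)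
    (F : ℕ → Polynomial ℝ) (l : ℕ) (y t : ℝ) : ℝ :=
  (P t).eval y - wSum k a b u0 F l y t

/-- `uh` is a DG solution on `[0,T]` on the mesh `x 0 < x 1 < … < x N`
(the piece on the cell `τ_j = (x (j-1), x j)` is the polynomial `uh j t`),
with prescribed inflow value `inflow t` at the left boundary. -/
def IsDGSol (k N : ℕ) (x : ℕ → ℝ) (T : ℝ) (inflow : ℝ → ℝ)
    (uh : ℕ → ℝ → Polynomial ℝ) : Prop :=
  (∀ j ∈ Finset.Icc 1 N, ∀ t : ℝ, (uh j t).natDegree ≤ k) ∧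
  (∀ j ∈ Finset.Icc 1 N, ∀ y : ℝ, ContDiff ℝ 1 (fun t => (uh j t).eval y)) ∧
  (∀ j ∈ Finset.Icc 1 N, ∀ t ∈ Set.Icc (0:ℝ) T, ∀ v : Polynomial ℝ, v.natDegree ≤ k →
    (∫ y in (x (j-1))..(x j), deriv (fun s => (uh j s).eval y) t * v.eval y)
      - (∫ y in (x (j-1))..(x j), (uh j t).eval y * v.derivative.eval y)
      + (uh j t).eval (x j) * v.eval (x j)
      - (if j = 1 then inflow t else (uh (j-1) t).eval (x (j-1))) * v.eval (x (j-1)) = 0)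

/-- The error `u - u_I^l` on the cell `τ_j`, as a function of `(y, s)`. -/
noncomputable def errFun (k l : ℕ) (x : ℕ → ℝ) (u0 : ℝ → ℝ)
    (P : ℕ → ℝ → Polynomial ℝ) (F : ℕ → ℕ → Polynomial ℝ) (j : ℕ) (y s : ℝ) : ℝ :=
  u0 (y - s) - uIl k (x (j-1)) (x j) u0 (P j) (F j) l y s

open Polynomial in
/-- Legendre polynomial as a polynomial. -/
noncomputable def Leg (m : ℕ) : Polynomial ℝ :=
  C (1 / ((2:ℝ) ^ m * (Nat.factorial m : ℝ))) * derivative^[m] ((X ^ 2 - 1) ^ m)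

theorem iteratedDeriv_poly (p : Polynomial ℝ) (n : ℕ) (s : ℝ) :
    iteratedDeriv n (fun t => p.eval t) s = (Polynomial.derivative^[n] p).eval s := by
  induction n generalizing p s with
  | zero => simp
  | succ n ih =>
    rw [iteratedDeriv_succ', Function.iterate_succ_apply, ← ih]
    congr 1
    ext t
    simp

theorem legendreP_eq (m : ℕ) (s : ℝ) : legendreP m s = (Leg m).eval s := by
  unfold legendreP Leg
  rw [Polynomial.eval_mul, Polynomial.eval_C, ← iteratedDeriv_poly]
  simp

theorem poly_ibp (p q : Polynomial ℝ) (a b : ℝ) :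
    (∫ y in a..b, p.eval y * q.derivative.eval y) =
      p.eval b * q.eval b - p.eval a * q.eval a - ∫ y in a..b, p.derivative.eval y * q.eval y := by
  apply intervalIntegral.integral_mul_deriv_eq_deriv_mul
  · intro x _; exact p.hasDerivAt x
  · intro x _; exact q.hasDerivAt x
  · exact (Polynomial.continuous _).intervalIntegrable _ _
  · exact (Polynomial.continuous _).intervalIntegrable _ _

theorem ibp_iter (a b : ℝ) (p : Polynomial ℝ) (n : ℕ)
    (h : ∀ i < n, (Polynomial.derivative^[i] p).eval a = 0 ∧
      (Polynomial.derivative^[i] p).eval b = 0) (v : Polynomial ℝ) :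
    (∫ y in a..b, v.eval y * (Polynomial.derivative^[n] p).eval y) =
      (-1) ^ n * ∫ y in a..b, (Polynomial.derivative^[n] v).eval y * p.eval y := by
  induction n generalizing v with
  | zero => simp
  | succ n ih =>
    rw [Function.iterate_succ_apply', poly_ibp, (h n (by omega)).1, (h n (by omega)).2,
      ih (fun i hi => h i (by omega)), Function.iterate_succ_apply]
    ring

open Polynomial in
theorem rod_vanish (m i : ℕ) (hi : i < m) (r : ℝ) (hr : r ^ 2 = 1) :
    (derivative^[i] ((X ^ 2 - 1 : ℝ[X]) ^ m)).eval r = 0 := by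
  have := aeval_iterate_derivative_of_lt (R := ℝ) (A := ℝ) ((X ^ 2 - 1 : ℝ[X]) ^ m) m r
    (p' := (X + C r) ^ m) (by
      rw [← mul_pow]
      simp only [Algebra.algebraMap_self, Polynomial.map_id]
      congr 1
      have : (C r : ℝ[X]) * C r = 1 := by rw [← C_mul, ← sq, hr, C_1]
      linear_combination this) hi
  simpa using this

open Polynomial in
theorem Leg_eval (m : ℕ) (r : ℝ) (hr : r ^ 2 = 1) : (Leg m).eval r = r ^ m := by
  have := aeval_iterate_derivative_self (R := ℝ) (A := ℝ) ((X ^ 2 - 1 : ℝ[X]) ^ m) m r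
    (p' := (X + C r) ^ m) (by
      rw [← mul_pow]
      simp only [Algebra.algebraMap_self, Polynomial.map_id]
      congr 1
      have : (C r : ℝ[X]) * C r = 1 := by rw [← C_mul, ← sq, hr, C_1]
      linear_combination this)
  unfold Leg
  simp only [coe_aeval_eq_eval] at this
  rw [eval_mul, eval_C, this]
  simp only [eval_pow, eval_add, eval_X, eval_C, nsmul_eq_mul]
  have hf : (m.factorial : ℝ) ≠ 0 := by positivity
  rw [← two_mul, mul_pow]
  field_simp

open Polynomial in
theorem Leg_orth (m : ℕ) (v : ℝ[X]) (hv : v.natDegree < m) :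
    (∫ y in (-1:ℝ)..1, v.eval y * (Leg m).eval y) = 0 := by
  have := ibp_iter (-1) 1 ((X ^ 2 - 1 : ℝ[X]) ^ m) m
    (fun i hi => ⟨rod_vanish m i hi _ (by norm_num), rod_vanish m i hi _ (by norm_num)⟩) v
  rw [iterate_derivative_eq_zero hv] at this
  simp only [eval_zero, zero_mul, intervalIntegral.integral_zero, mul_zero] at this
  unfold Leg
  simp only [eval_mul, eval_C, mul_left_comm]
  rw [intervalIntegral.integral_const_mul, this, mul_zero]

open Polynomial in
theorem Leg_natDegree_le (m : ℕ) : (Leg m).natDegree ≤ m := by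
  unfold Leg
  refine (natDegree_C_mul_le _ _).trans ((natDegree_iterate_derivative _ _).trans ?_)
  have : ((X ^ 2 - 1 : ℝ[X]) ^ m).natDegree ≤ m * 2 := by
    refine natDegree_pow_le_of_le m ?_
    compute_degree
  omega

open Polynomial in
theorem Leg_coeff_ne (m : ℕ) : (Leg m).coeff m ≠ 0 := by
  unfold Leg
  rw [coeff_C_mul, coeff_iterate_derivative]
  have hm : ((X ^ 2 - 1 : ℝ[X]) ^ m).coeff (m + m) = 1 := by
    have h2 : (X ^ 2 - 1 : ℝ[X]).Monic := by
      have := monic_X_pow_sub_C (1:ℝ) (n := 2) (by norm_num)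
      simpa using this
    have h3 := h2.pow m
    have h4 : ((X ^ 2 - 1 : ℝ[X]) ^ m).natDegree = m + m := by
      rw [h2.natDegree_pow]
      have : (X ^ 2 - 1 : ℝ[X]).natDegree = 2 := by
        have := natDegree_X_pow_sub_C (n := 2) (r := (1:ℝ))
        simpa using this
      rw [this]; ring
    rw [← h4]; exact h3
  rw [hm]
  have : (m + m).descFactorial m ≠ 0 := by
    rw [Ne, Nat.descFactorial_eq_zero_iff_lt]; omega
  simp only [nsmul_eq_mul, mul_one]
  have h5 : ((m + m).descFactorial m : ℝ) ≠ 0 := by exact_mod_cast this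
  positivity

open Polynomial in
/-- squared norm -/
theorem Leg_norm (m : ℕ) : (∫ y in (-1:ℝ)..1, (Leg m).eval y * (Leg m).eval y) = 2 / (2 * m + 1) := by
  have h1 := poly_ibp (X * Leg m) (Leg m) (-1) 1
  -- X L' = m L + lower
  have h2 : ∃ r : ℝ[X], (m = 0 ∧ r = 0 ∨ r.natDegree < m) ∧
      X * derivative (Leg m) = C (m:ℝ) * Leg m + r := by
    refine ⟨X * derivative (Leg m) - C (m:ℝ) * Leg m, ?_, by ring⟩
    rcases Nat.eq_zero_or_pos m with rfl | hm
    · left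
      refine ⟨rfl, ?_⟩
      have : (Leg 0) = C ((Leg 0).coeff 0) := eq_C_of_natDegree_le_zero (Leg_natDegree_le 0)
      rw [this]; simp
    · right
      refine Nat.lt_of_le_pred hm (natDegree_le_iff_coeff_eq_zero.2 ?_)
      intro n hn'
      have hn : m ≤ n := by have : m - 1 < n := hn'
                            omega
      rw [coeff_sub, coeff_C_mul]
      obtain ⟨n, rfl⟩ : ∃ n', n = n' + 1 := ⟨n - 1, by omega⟩
      rw [coeff_X_mul, coeff_derivative]
      rcases hn.eq_or_lt with h | h
      · rw [h]; push_cast; ring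
      · rw [coeff_eq_zero_of_natDegree_lt (lt_of_le_of_lt (Leg_natDegree_le m) h)]; simp
  obtain ⟨r, hr, h2⟩ := h2
  have h3 : (∫ y in (-1:ℝ)..1, r.eval y * (Leg m).eval y) = 0 := by
    rcases hr with ⟨_, rfl⟩ | hr
    · simp
    · exact Leg_orth m r hr
  have h4 : ∀ y, (X * Leg m : ℝ[X]).eval y * (derivative (Leg m)).eval y =
      m * ((Leg m).eval y * (Leg m).eval y) + r.eval y * (Leg m).eval y := by
    intro y
    have := congrArg (eval y) h2
    simp only [eval_mul, eval_X, eval_add, eval_C] at this ⊢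
    linear_combination (eval y (Leg m)) * this
  have h5 : ∀ y, (derivative (X * Leg m : ℝ[X])).eval y * (Leg m).eval y =
      (m + 1) * ((Leg m).eval y * (Leg m).eval y) + r.eval y * (Leg m).eval y := by
    intro y
    rw [derivative_mul, derivative_X, one_mul, h2]
    simp only [eval_mul, eval_add, eval_C]
    ring
  simp only [h4, h5] at h1
  have ci : ∀ (f : ℝ → ℝ), Continuous f → IntervalIntegrable f volume (-1:ℝ) 1 :=
    fun f hf => hf.intervalIntegrable _ _
  rw [intervalIntegral.integral_add (ci _ (by fun_prop)) (ci _ (by fun_prop)),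
    intervalIntegral.integral_add (ci _ (by fun_prop)) (ci _ (by fun_prop)),
    intervalIntegral.integral_const_mul, intervalIntegral.integral_const_mul, h3] at h1
  have e1 := Leg_eval m 1 (by norm_num)
  have e2 := Leg_eval m (-1) (by norm_num)
  simp only [eval_mul, eval_X, e1, e2] at h1
  have e3 : ((-1:ℝ) ^ m) * ((-1:ℝ) ^ m) = 1 := by rw [← mul_pow]; norm_num
  have : (0:ℝ) < 2 * m + 1 := by positivity
  rw [eq_div_iff this.ne']
  simp only [one_pow] at h1
  linear_combination h1 + e3

open Polynomial in
theorem Leg_expand_exists (k : ℕ) (v : ℝ[X]) (hv : v.natDegree ≤ k) :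
    ∃ c : ℕ → ℝ, v = ∑ l ∈ Finset.range (k + 1), C (c l) * Leg l := by
  induction k generalizing v with
  | zero =>
    refine ⟨fun _ => v.coeff 0, ?_⟩
    have h0 : Leg 0 = 1 := by simp [Leg]
    simp only [zero_add, Finset.range_one, Finset.sum_singleton, h0, mul_one]
    exact eq_C_of_natDegree_le_zero hv
  | succ k ih =>
    have hne := Leg_coeff_ne (k + 1)
    set d := v.coeff (k + 1) / (Leg (k + 1)).coeff (k + 1) with hd
    obtain ⟨c, hc⟩ := ih (v - C d * Leg (k + 1)) (by
      rw [natDegree_le_iff_coeff_eq_zero]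
      intro n hn
      rw [coeff_sub, coeff_C_mul]
      rcases (show k + 1 ≤ n from hn).eq_or_lt with h | h
      · rw [← h, hd]; field_simp; ring
      · rw [coeff_eq_zero_of_natDegree_lt (lt_of_le_of_lt (Leg_natDegree_le _) h),
          coeff_eq_zero_of_natDegree_lt (lt_of_le_of_lt hv h)]; simp)
    refine ⟨fun l => if l = k + 1 then d else c l, ?_⟩
    rw [Finset.sum_range_succ]
    simp only [if_true]
    rw [← sub_eq_iff_eq_add, hc]
    apply Finset.sum_congr rfl
    intro l hl
    rw [if_neg (by have := Finset.mem_range.1 hl; omega)]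

open Polynomial in
theorem Leg_orth' (l m : ℕ) :
    (∫ y in (-1:ℝ)..1, (Leg l).eval y * (Leg m).eval y) = if l = m then 2 / (2 * (m:ℝ) + 1) else 0 := by
  split_ifs with h
  · rw [h]; exact Leg_norm m
  · rcases Nat.lt_or_gt_of_ne h with h | h
    · exact Leg_orth _ _ (lt_of_le_of_lt (Leg_natDegree_le _) h)
    · simp only [mul_comm (eval _ (Leg l))]
      exact Leg_orth _ _ (lt_of_le_of_lt (Leg_natDegree_le _) h)

open Polynomial in
theorem Leg_expand (k : ℕ) (v : ℝ[X]) (hv : v.natDegree ≤ k) :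
    v = ∑ l ∈ Finset.range (k + 1),
      C ((2 * (l:ℝ) + 1) / 2 * ∫ y in (-1:ℝ)..1, v.eval y * (Leg l).eval y) * Leg l := by
  obtain ⟨c, hc⟩ := Leg_expand_exists k v hv
  have : ∀ l ∈ Finset.range (k + 1),
      (∫ y in (-1:ℝ)..1, v.eval y * (Leg l).eval y) = c l * (2 / (2 * (l:ℝ) + 1)) := by
    intro l hl
    rw [hc]
    simp only [eval_finsetSum, eval_mul, eval_C, Finset.sum_mul, mul_assoc]
    rw [intervalIntegral.integral_finsetSum]
    · simp only [intervalIntegral.integral_const_mul, Leg_orth']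
      simp [Finset.mem_range.1 hl]
    · intro i _
      exact Continuous.intervalIntegrable (by fun_prop) _ _
  conv_lhs => rw [hc]
  apply Finset.sum_congr rfl
  intro l hl
  rw [this l hl]
  congr 2
  have : (0:ℝ) < 2 * l + 1 := by positivity
  field_simp
open Polynomial in
/-- Cell Legendre polynomial as a polynomial. -/
noncomputable def LegC (m : ℕ) (a b : ℝ) : ℝ[X] :=
  (Leg m).comp (C (2 / (b - a)) * X + C (-(a + b) / (b - a)))

open Polynomial in
theorem legendreCell_eq (m : ℕ) (a b y : ℝ) : legendreCell m a b y = (LegC m a b).eval y := by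
  unfold legendreCell LegC
  rw [legendreP_eq, eval_comp]
  congr 1
  simp
  ring

open Polynomial in
theorem natDegree_comp_affine_le (p : ℝ[X]) (c d : ℝ) :
    (p.comp (C c * X + C d)).natDegree ≤ p.natDegree := by
  refine natDegree_comp_le.trans ?_
  have : (C c * X + C d : ℝ[X]).natDegree ≤ 1 := natDegree_linear_le
  nlinarith

theorem LegC_natDegree_le (m : ℕ) (a b : ℝ) : (LegC m a b).natDegree ≤ m :=
  (natDegree_comp_affine_le _ _ _).trans (Leg_natDegree_le m)

theorem LegC_right (m : ℕ) (a b : ℝ) (hab : a < b) : (LegC m a b).eval b = 1 := by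
  unfold LegC
  rw [Polynomial.eval_comp]
  have : (2 / (b - a)) * b + (-(a + b) / (b - a)) = 1 := by
    have : b - a ≠ 0 := by linarith
    field_simp; ring
  simp only [Polynomial.eval_add, Polynomial.eval_mul, Polynomial.eval_C, Polynomial.eval_X, this]
  rw [Leg_eval _ _ (by norm_num)]; simp

theorem int_change (f : ℝ → ℝ) (a b : ℝ) (hab : a < b) :
    (∫ y in a..b, f y) = (b - a) / 2 * ∫ s in (-1:ℝ)..1, f ((b - a) / 2 * s + (a + b) / 2) := by
  have h0 : (b - a) / 2 ≠ 0 := by intro h; linarith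
  rw [intervalIntegral.integral_comp_mul_add f h0]
  rw [smul_eq_mul, ← mul_assoc, mul_inv_cancel₀ h0, one_mul]
  congr 1 <;> ring

theorem cell_inv (a b s : ℝ) (hab : a < b) :
    2 / (b - a) * ((b - a) / 2 * s + (a + b) / 2) + -(a + b) / (b - a) = s := by
  have : b - a ≠ 0 := by linarith
  field_simp; ring

open Polynomial in
theorem LegC_back (m : ℕ) (a b s : ℝ) (hab : a < b) :
    (LegC m a b).eval ((b - a) / 2 * s + (a + b) / 2) = (Leg m).eval s := by
  unfold LegC
  rw [eval_comp]
  congr 1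
  simp only [eval_add, eval_mul, eval_C, eval_X]
  exact cell_inv a b s hab

open Polynomial in
theorem LegC_expand (k : ℕ) (a b : ℝ) (hab : a < b) (v : ℝ[X]) (hv : v.natDegree ≤ k) (y : ℝ) :
    v.eval y = ∑ l ∈ Finset.range (k + 1),
      ((2 * (l:ℝ) + 1) / (b - a) * ∫ y in a..b, v.eval y * (LegC l a b).eval y) *
        (LegC l a b).eval y := by
  have h := Leg_expand k (v.comp (C ((b - a) / 2) * X + C ((a + b) / 2)))
    ((natDegree_comp_affine_le _ _ _).trans hv)
  have hba : b - a ≠ 0 := by linarith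
  have h2 := congrArg (eval (2 / (b - a) * y + -(a + b) / (b - a))) h
  rw [eval_finsetSum, eval_comp] at h2
  simp only [eval_add, eval_mul, eval_C, eval_X, eval_comp] at h2
  have e : (b - a) / 2 * (2 / (b - a) * y + -(a + b) / (b - a)) + (a + b) / 2 = y := by
    field_simp; ring
  rw [e] at h2
  rw [h2]
  apply Finset.sum_congr rfl
  intro l _
  rw [int_change _ a b hab]
  simp only [LegC_back _ _ _ _ hab]
  have : (Leg l).eval (2 / (b - a) * y + -(a + b) / (b - a)) = (LegC l a b).eval y := by
    simp [LegC, eval_comp]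
  rw [this]
  field_simp

open Polynomial in
theorem LegC_orth (m : ℕ) (a b : ℝ) (hab : a < b) (v : ℝ[X]) (hv : v.natDegree < m) :
    (∫ y in a..b, (LegC m a b).eval y * v.eval y) = 0 := by
  rw [int_change _ a b hab]
  simp only [LegC_back _ _ _ _ hab]
  have := Leg_orth m (v.comp (C ((b - a) / 2) * X + C ((a + b) / 2)))
    (lt_of_le_of_lt (natDegree_comp_affine_le _ _ _) hv)
  simp only [eval_add, eval_mul, eval_C, eval_X, eval_comp] at this
  simp only [mul_comm (eval _ (Leg m)), this, mul_zero]

theorem radau_eq (a b : ℝ) (w : ℝ → ℝ) (hw : Continuous w) (m : ℕ) :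
    radauCoeff a b w m = w b - ∑ l ∈ Finset.range m,
      (2 * (l:ℝ) + 1) / (b - a) * ∫ y in a..b, w y * (LegC l a b).eval y := by
  unfold radauCoeff
  congr 1
  simp only [Finset.mul_sum, legendreCell_eq]
  rw [intervalIntegral.integral_finsetSum, Finset.mul_sum]
  · apply Finset.sum_congr rfl
    intro l _
    simp only [mul_left_comm (w _)]
    rw [intervalIntegral.integral_const_mul]
    ring
  · intro i _
    exact Continuous.intervalIntegrable (by fun_prop) _ _

/-- Key structure of the Gauss-Radau projection. -/
theorem gr_coeff (k : ℕ) (a b : ℝ) (hab : a < b) (u : ℝ → ℝ) (hu : Continuous u)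
    (P : Polynomial ℝ) (hP : IsGRProj k a b u P) :
    (∀ l < k, (∫ y in a..b, P.eval y * (LegC l a b).eval y) =
      ∫ y in a..b, u y * (LegC l a b).eval y) ∧
    (2 * (k:ℝ) + 1) / (b - a) * (∫ y in a..b, P.eval y * (LegC k a b).eval y) =
      (2 * (k:ℝ) + 1) / (b - a) * (∫ y in a..b, u y * (LegC k a b).eval y)
        + radauCoeff a b u (k + 1) := by
  have h1 : ∀ l < k, (∫ y in a..b, P.eval y * (LegC l a b).eval y) =
      ∫ y in a..b, u y * (LegC l a b).eval y := fun l hl =>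
    hP.2.1 _ (by have := LegC_natDegree_le l a b; omega)
  refine ⟨h1, ?_⟩
  have h2 := LegC_expand k a b hab P hP.1 b
  rw [hP.2.2, Finset.sum_range_succ] at h2
  rw [radau_eq a b u hu, Finset.sum_range_succ]
  simp only [LegC_right _ _ _ hab, mul_one] at h2
  rw [Finset.sum_congr rfl (fun l hl => by rw [h1 l (Finset.mem_range.1 hl)])] at h2
  linarith

theorem gr_eval (k : ℕ) (a b : ℝ) (hab : a < b) (u : ℝ → ℝ) (hu : Continuous u)
    (P : Polynomial ℝ) (hP : IsGRProj k a b u P) (y : ℝ) :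
    P.eval y = (∑ l ∈ Finset.range (k + 1),
      ((2 * (l:ℝ) + 1) / (b - a) * ∫ y in a..b, u y * (LegC l a b).eval y) *
        (LegC l a b).eval y) + radauCoeff a b u (k + 1) * (LegC k a b).eval y := by
  obtain ⟨h1, h2⟩ := gr_coeff k a b hab u hu P hP
  rw [LegC_expand k a b hab P hP.1 y, Finset.sum_range_succ, Finset.sum_range_succ, h2]
  rw [Finset.sum_congr rfl (fun l hl => by rw [h1 l (Finset.mem_range.1 hl)])]
  ring

theorem int_expand (k : ℕ) (a b : ℝ) (hab : a < b) (u : ℝ → ℝ) (hu : Continuous u)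
    (v : Polynomial ℝ) (hv : v.natDegree ≤ k) :
    (∫ y in a..b, u y * v.eval y) = ∑ l ∈ Finset.range (k + 1),
      ((2 * (l:ℝ) + 1) / (b - a) * ∫ y in a..b, v.eval y * (LegC l a b).eval y) *
        ∫ y in a..b, u y * (LegC l a b).eval y := by
  have : ∀ y, u y * v.eval y = ∑ l ∈ Finset.range (k + 1),
      ((2 * (l:ℝ) + 1) / (b - a) * ∫ y in a..b, v.eval y * (LegC l a b).eval y) *
        (u y * (LegC l a b).eval y) := by
    intro y
    conv_lhs => rw [LegC_expand k a b hab v hv y]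
    rw [Finset.mul_sum]
    apply Finset.sum_congr rfl
    intro l _
    ring
  simp only [this]
  rw [intervalIntegral.integral_finsetSum]
  · simp only [intervalIntegral.integral_const_mul]
  · intro i _
    exact Continuous.intervalIntegrable (by fun_prop) _ _

theorem gr_test (k : ℕ) (a b : ℝ) (hab : a < b) (u : ℝ → ℝ) (hu : Continuous u)
    (P : Polynomial ℝ) (hP : IsGRProj k a b u P) (v : Polynomial ℝ) (hv : v.natDegree ≤ k) :
    (∫ y in a..b, P.eval y * v.eval y) = (∫ y in a..b, u y * v.eval y)
      + radauCoeff a b u (k + 1) * ∫ y in a..b, (LegC k a b).eval y * v.eval y := by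
  obtain ⟨h1, h2⟩ := gr_coeff k a b hab u hu P hP
  rw [int_expand k a b hab (fun y => P.eval y) P.continuous v hv, int_expand k a b hab u hu v hv,
    Finset.sum_range_succ, Finset.sum_range_succ]
  rw [Finset.sum_congr rfl (fun l hl => by rw [h1 l (Finset.mem_range.1 hl)])]
  simp only [mul_comm (Polynomial.eval _ (LegC k a b)) (Polynomial.eval _ v)]
  linear_combination (∫ y in a..b, v.eval y * (LegC k a b).eval y) * h2

theorem radau_poly (k : ℕ) (a b : ℝ) (hab : a < b) (p : Polynomial ℝ) (hp : p.natDegree ≤ k) :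
    radauCoeff a b (fun y => p.eval y) (k + 1) = 0 := by
  rw [radau_eq _ _ _ p.continuous]
  have := LegC_expand k a b hab p hp b
  simp only [LegC_right _ _ _ hab, mul_one] at this
  linarith

theorem legendreP_bound (k : ℕ) : ∃ S : ℝ, 0 ≤ S ∧ ∀ a b : ℝ, a < b → ∀ y ∈ Set.Icc a b,
    |∑ l ∈ Finset.range (k + 1), (2 * (l:ℝ) + 1) * legendreCell l a b y| ≤ S := by
  have hcont : Continuous (fun s : ℝ => ∑ l ∈ Finset.range (k + 1), (2 * (l:ℝ) + 1) * (Leg l).eval s) := by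
    fun_prop
  obtain ⟨S, hS⟩ := (isCompact_Icc (a := (-1:ℝ)) (b := 1)).exists_bound_of_continuousOn
    hcont.continuousOn
  refine ⟨S, (norm_nonneg _).trans (hS 0 (by norm_num)), ?_⟩
  intro a b hab y hy
  have hba : 0 < b - a := by linarith
  have := hS ((2 * y - (a + b)) / (b - a)) (by
    constructor
    · rw [le_div_iff₀ hba]; linarith [hy.1]
    · rw [div_le_iff₀ hba]; linarith [hy.2])
  simpa only [legendreCell, legendreP_eq, Real.norm_eq_abs] using this

theorem radau_sub (a b : ℝ) (w p : ℝ → ℝ) (hw : Continuous w) (hp : Continuous p) (m : ℕ) :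
    radauCoeff a b (fun y => w y - p y) m = radauCoeff a b w m - radauCoeff a b p m := by
  rw [radau_eq _ _ _ hw, radau_eq _ _ _ hp, radau_eq _ _ (fun y => w y - p y) (hw.sub hp)]
  simp only [sub_mul]
  rw [Finset.sum_congr rfl (fun l _ => by
    rw [intervalIntegral.integral_sub (Continuous.intervalIntegrable (by fun_prop) _ _)
      (Continuous.intervalIntegrable (by fun_prop) _ _), mul_sub])]
  rw [Finset.sum_sub_distrib]
  ring

theorem radau_sup (a b : ℝ) (hab : a < b) (w : ℝ → ℝ) (m : ℕ)
    (S B : ℝ) (hB0 : 0 ≤ B)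
    (hS : ∀ y ∈ Set.Icc a b, |∑ l ∈ Finset.range m, (2 * (l:ℝ) + 1) * legendreCell l a b y| ≤ S)
    (hB : ∀ y ∈ Set.Icc a b, |w y| ≤ B) : |radauCoeff a b w m| ≤ (1 + S) * B := by
  unfold radauCoeff
  have hba : 0 < b - a := by linarith
  have h1 := intervalIntegral.norm_integral_le_of_norm_le_const (a := a) (b := b) (C := B * S)
    (f := fun x => w x * ∑ l ∈ Finset.range m, (2 * (l:ℝ) + 1) * legendreCell l a b x) (by
      intro x hx
      rw [Set.uIoc_of_le hab.le] at hx
      have hx' : x ∈ Set.Icc a b := ⟨hx.1.le, hx.2⟩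
      rw [norm_mul]
      exact mul_le_mul (hB x hx') (hS x hx') (norm_nonneg _) hB0)
  rw [Real.norm_eq_abs, abs_of_pos hba] at h1
  refine (abs_sub _ _).trans ?_
  rw [abs_mul, abs_of_pos (by positivity : 0 < 1 / (b - a))]
  have h2 := hB b ⟨hab.le, le_rfl⟩
  have h3 := mul_le_mul_of_nonneg_left h1 (by positivity : 0 ≤ 1 / (b - a))
  have h4 : 1 / (b - a) * (B * S * (b - a)) = B * S := by field_simp
  linarith

theorem radau_bound (k : ℕ) : ∃ K : ℝ, 0 ≤ K ∧ ∀ a b : ℝ, a < b → ∀ w : ℝ → ℝ,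
    ContDiff ℝ (k + 1) w → ∀ M : ℝ, (∀ y ∈ Set.Icc a b, |iteratedDeriv (k + 1) w y| ≤ M) →
    |radauCoeff a b w (k + 1)| ≤ K * (b - a) ^ (k + 1) * M := by
  obtain ⟨S, hS0, hS⟩ := legendreP_bound k
  refine ⟨1 + S, by linarith, ?_⟩
  intro a b hab w hw M hM
  have hM0 : 0 ≤ M := (abs_nonneg _).trans (hM a ⟨le_rfl, hab.le⟩)
  have hba : 0 < b - a := by linarith
  set p : Polynomial ℝ := ∑ i ∈ Finset.range (k + 1),
    Polynomial.C ((i.factorial : ℝ)⁻¹ * iteratedDerivWithin i w (Set.Icc a b) a) *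
      (Polynomial.X - Polynomial.C a) ^ i with hpdef
  have hpdeg : p.natDegree ≤ k := by
    apply Polynomial.natDegree_sum_le_of_forall_le
    intro i hi
    refine (Polynomial.natDegree_C_mul_le _ _).trans ?_
    rw [Polynomial.natDegree_pow, Polynomial.natDegree_X_sub_C]
    have := Finset.mem_range.1 hi
    omega
  have hpe : ∀ y, p.eval y = taylorWithinEval w k (Set.Icc a b) a y := by
    intro y
    rw [taylor_within_apply, hpdef, Polynomial.eval_finsetSum]
    apply Finset.sum_congr rfl
    intro i _
    simp
    ring
  have hB : ∀ y ∈ Set.Icc a b, |w y - p.eval y| ≤ (b - a) ^ (k + 1) * M := by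
    intro y hy
    have h1 := taylor_mean_remainder_bound (n := k) hab.le (hw.contDiffOn) hy (C := M) (by
      intro z hz
      rw [iteratedDerivWithin_eq_iteratedDeriv (uniqueDiffOn_Icc hab) _ hz]
      · exact hM z hz
      · exact_mod_cast hw.contDiffAt)
    rw [← hpe, Real.norm_eq_abs] at h1
    refine h1.trans ?_
    have h2 : (1:ℝ) ≤ k.factorial := by exact_mod_cast Nat.factorial_pos k
    have h3 : (y - a) ^ (k + 1) ≤ (b - a) ^ (k + 1) :=
      pow_le_pow_left₀ (by linarith [hy.1]) (by linarith [hy.2]) _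
    have h0 : 0 ≤ M * (y - a) ^ (k + 1) := mul_nonneg hM0 (pow_nonneg (by linarith [hy.1]) _)
    refine (div_le_self h0 h2).trans ?_
    nlinarith
  have h5 := radau_sup a b hab (fun y => w y - p.eval y) (k + 1) S _ (by positivity) (hS a b hab) hB
  rw [radau_sub a b w _ hw.continuous p.continuous, radau_poly k a b hab p hpdeg, sub_zero] at h5
  linarith
theorem hasDerivAt_conv (f q : ℝ → ℝ) (hf : ContDiff ℝ 1 f) (hq : Continuous q) (a b t : ℝ) :
    HasDerivAt (fun s => ∫ y in a..b, f (y - s) * q y)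
      (-(∫ y in a..b, deriv f (y - t) * q y)) t := by
  have hf' : Continuous (deriv f) := hf.continuous_deriv le_rfl
  have hfc : Continuous f := hf.continuous
  have hc : Continuous (fun z : ℝ × ℝ => deriv f (z.2 - z.1) * q z.2) := by fun_prop
  obtain ⟨B, hB⟩ := ((isCompact_Icc (a := t - 1) (b := t + 1)).prod
    (isCompact_uIcc (a := a) (b := b))).exists_bound_of_continuousOn hc.continuousOn
  have := intervalIntegral.hasDerivAt_integral_of_dominated_loc_of_deriv_le
    (F := fun s y => f (y - s) * q y) (F' := fun s y => -(deriv f (y - s) * q y))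
    (x₀ := t) (s := Set.Icc (t - 1) (t + 1)) (a := a) (b := b) (μ := volume) (bound := fun _ => B)
    (Icc_mem_nhds (by linarith) (by linarith))
    (Filter.Eventually.of_forall fun s => (Continuous.aestronglyMeasurable (by fun_prop)))
    (Continuous.intervalIntegrable (by fun_prop) _ _)
    (Continuous.aestronglyMeasurable (by fun_prop))
    (Filter.Eventually.of_forall fun y hy s hs => by
      rw [norm_neg]
      exact hB (s, y) ⟨hs, Set.uIoc_subset_uIcc hy⟩)
    (by simp)
    (Filter.Eventually.of_forall fun y hy s hs => by
      have h1 : HasDerivAt f (deriv f (y - s)) (y - s) :=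
        ((hf.differentiable one_ne_zero) _).hasDerivAt
      have h2 : HasDerivAt (fun s => y - s) (-1) s := by
        simpa using (hasDerivAt_id s).const_sub y
      have h3 := (h1.comp s h2).mul_const (q y)
      refine HasDerivAt.congr_deriv h3 ?_
      ring)
  rw [← intervalIntegral.integral_neg]
  exact this.2

theorem hasDerivAt_shift (f : ℝ → ℝ) (hf : ContDiff ℝ 1 f) (y t : ℝ) :
    HasDerivAt (fun s => f (y - s)) (-(deriv f (y - t))) t := by
  have h1 : HasDerivAt f (deriv f (y - t)) (y - t) :=
    ((hf.differentiable one_ne_zero) _).hasDerivAt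
  have h2 : HasDerivAt (fun s => y - s) (-1) t := by
    simpa using (hasDerivAt_id t).const_sub y
  have h3 := (h1.comp t h2)
  refine HasDerivAt.congr_deriv h3 ?_
  ring

theorem hasDerivAt_radau (f : ℝ → ℝ) (hf : ContDiff ℝ 1 f) (a b t : ℝ) (m : ℕ) :
    HasDerivAt (fun s => radauCoeff a b (fun y => f (y - s)) m)
      (-(radauCoeff a b (fun y => deriv f (y - t)) m)) t := by
  have hf' : Continuous (deriv f) := hf.continuous_deriv le_rfl
  have hfc : Continuous f := hf.continuous
  have e : (fun s => radauCoeff a b (fun y => f (y - s)) m) = fun s => f (b - s) -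
      ∑ l ∈ Finset.range m, (2 * (l:ℝ) + 1) / (b - a) *
        ∫ y in a..b, f (y - s) * (LegC l a b).eval y := by
    ext s
    rw [radau_eq _ _ _ (by fun_prop)]
  rw [e, radau_eq _ _ _ (by fun_prop)]
  have := (hasDerivAt_shift f hf b t).sub (HasDerivAt.fun_sum (u := Finset.range m) (fun l _ =>
    (hasDerivAt_conv f _ hf (LegC l a b).continuous a b t).const_mul ((2 * (l:ℝ) + 1) / (b - a))))
  refine HasDerivAt.congr_deriv this ?_
  simp only [mul_neg, Finset.sum_neg_distrib]
  ring

theorem contDiff_iter (u0 : ℝ → ℝ) (n i m : ℕ) (hu : ContDiff ℝ n u0) (h : m + i ≤ n) :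
    ContDiff ℝ m (iteratedDeriv i u0) := by
  have h2 : ContDiff ℝ ((m + i : ℕ) : WithTop ℕ∞) u0 := hu.of_le (by exact_mod_cast h)
  rw [iteratedDeriv_eq_iterate]
  exact ContDiff.iterate_deriv' m i (by exact_mod_cast h2)

theorem G_formula (k : ℕ) (a b : ℝ) (u0 : ℝ → ℝ) (n : ℕ) (hu : ContDiff ℝ n u0) (i : ℕ)
    (hi : i ≤ n) (t : ℝ) :
    Gfun k a b u0 i t = (-1) ^ i * radauCoeff a b (fun y => iteratedDeriv i u0 (y - t)) (k + 1) := by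
  induction i generalizing t with
  | zero => simp [Gfun]
  | succ i ih =>
    have e : iteratedDeriv i (fun s => radauCoeff a b (fun y => u0 (y - s)) (k + 1)) =
        fun t => (-1) ^ i * radauCoeff a b (fun y => iteratedDeriv i u0 (y - t)) (k + 1) := by
      ext s
      exact ih (by omega) s
    unfold Gfun
    rw [iteratedDeriv_succ, e]
    have h1 := (hasDerivAt_radau (iteratedDeriv i u0)
      (by exact_mod_cast contDiff_iter u0 n i 1 hu (by omega)) a b t (k + 1)).const_mul ((-1:ℝ) ^ i)
    rw [h1.deriv, iteratedDeriv_succ]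
    ring

theorem G_hasDeriv (k : ℕ) (a b : ℝ) (u0 : ℝ → ℝ) (n : ℕ) (hu : ContDiff ℝ n u0) (i : ℕ)
    (hi : i + 1 ≤ n) (t : ℝ) :
    HasDerivAt (fun s => Gfun k a b u0 i s) (Gfun k a b u0 (i + 1) t) t := by
  rw [G_formula k a b u0 n hu (i + 1) hi]
  have e : (fun s => Gfun k a b u0 i s) =
        fun t => (-1) ^ i * radauCoeff a b (fun y => iteratedDeriv i u0 (y - t)) (k + 1) := by
    ext s
    exact G_formula k a b u0 n hu i (by omega) s
  rw [e]
  have h1 := (hasDerivAt_radau (iteratedDeriv i u0)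
      (by exact_mod_cast contDiff_iter u0 n i 1 hu (by omega)) a b t (k + 1)).const_mul ((-1:ℝ) ^ i)
  refine HasDerivAt.congr_deriv h1 ?_
  rw [iteratedDeriv_succ]
  ring

theorem G_bound (k : ℕ) : ∃ K : ℝ, 0 ≤ K ∧ ∀ a b : ℝ, a < b → ∀ u0 : ℝ → ℝ,
    ContDiff ℝ ((2 * k + 2 : ℕ) : WithTop ℕ∞) u0 → ∀ i ≤ k + 1, ∀ M t : ℝ,
    (∀ j ≤ 2 * k + 2, ∀ y ∈ Set.Icc a b, |iteratedDeriv j u0 (y - t)| ≤ M) →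
    |Gfun k a b u0 i t| ≤ K * (b - a) ^ (k + 1) * M := by
  obtain ⟨K, hK, hb⟩ := radau_bound k
  refine ⟨K, hK, ?_⟩
  intro a b hab u0 hu i hi M t hM
  rw [G_formula k a b u0 _ hu i (by omega), abs_mul, abs_pow, abs_neg, abs_one, one_pow, one_mul]
  have hc := contDiff_iter u0 _ i (k + 1) hu (by omega)
  apply hb a b hab
  · have : ContDiff ℝ ((k + 1 : ℕ) : WithTop ℕ∞) fun y => iteratedDeriv i u0 (y - t) :=
      hc.comp (contDiff_id.sub contDiff_const)
    exact_mod_cast this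
  · intro y hy
    have : iteratedDeriv (k + 1) (fun y => iteratedDeriv i u0 (y - t)) y =
        iteratedDeriv (k + 1 + i) u0 (y - t) := by
      rw [iteratedDeriv_comp_sub_const]
      show iteratedDeriv (k + 1) (iteratedDeriv i u0) (y - t) = _
      rw [iteratedDeriv_eq_iterate, iteratedDeriv_eq_iterate, iteratedDeriv_eq_iterate,
        Function.iterate_add_apply deriv (k + 1) i]
    rw [this]
    exact hM _ (by omega) y hy

theorem lag (k : ℕ) : ∃ ℓ : ℕ → Polynomial ℝ, ∀ p : Polynomial ℝ, p.natDegree ≤ k → ∀ y,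
    p.eval y = ∑ i ∈ Finset.range (k + 1), p.eval (i:ℝ) * (ℓ i).eval y := by
  refine ⟨fun i => Lagrange.basis (Finset.range (k + 1)) (fun i : ℕ => (i:ℝ)) i, ?_⟩
  intro p hp y
  have := Lagrange.eq_interpolate (f := p) (s := Finset.range (k + 1)) (v := fun i : ℕ => (i:ℝ))
    (fun i _ j _ h => by simpa using h) (by
      rw [Finset.card_range]
      exact lt_of_le_of_lt (Polynomial.degree_le_of_natDegree_le hp) (by exact_mod_cast Nat.lt_succ_self k))
  conv_lhs => rw [this]
  rw [Lagrange.interpolate_apply, Polynomial.eval_finsetSum]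
  simp

/-- time derivative of a polynomial-valued curve -/
theorem poly_curve (k : ℕ) (p : ℝ → Polynomial ℝ) (hp : ∀ s, (p s).natDegree ≤ k) (t : ℝ)
    (hd : ∀ y, DifferentiableAt ℝ (fun s => (p s).eval y) t) :
    Continuous (fun y => deriv (fun s => (p s).eval y) t) ∧
    (∀ (a b : ℝ) (v : ℝ → ℝ), Continuous v →
      HasDerivAt (fun s => ∫ y in a..b, (p s).eval y * v y)
      (∫ y in a..b, deriv (fun s => (p s).eval y) t * v y) t) ∧
    (∀ a b : ℝ, HasDerivAt (fun s => ∫ y in a..b, (p s).eval y * (p s).eval y)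
      (2 * ∫ y in a..b, deriv (fun s => (p s).eval y) t * (p t).eval y) t) := by
  obtain ⟨ℓ, hl⟩ := lag k
  obtain ⟨D, hD⟩ : ∃ D : ℕ → ℝ, ∀ i : ℕ, HasDerivAt (fun s => (p s).eval (i:ℝ)) (D i) t :=
    ⟨fun i => deriv (fun s => (p s).eval (i:ℝ)) t, fun i => (hd i).hasDerivAt⟩
  have hder : ∀ y, HasDerivAt (fun s => (p s).eval y)
      (∑ i ∈ Finset.range (k + 1), D i * (ℓ i).eval y) t := by
    intro y
    have e : (fun s => (p s).eval y) = fun s => ∑ i ∈ Finset.range (k + 1),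
      (p s).eval (i:ℝ) * (ℓ i).eval y := by
      ext s; exact hl _ (hp s) y
    rw [e]
    exact HasDerivAt.fun_sum fun i _ => ((hD i).mul_const _)
  have hde : ∀ y, deriv (fun s => (p s).eval y) t =
      ∑ i ∈ Finset.range (k + 1), D i * (ℓ i).eval y :=
    fun y => (hder y).deriv
  have key : ∀ (a b : ℝ) (v : ℝ → ℝ), Continuous v →
      HasDerivAt (fun s => ∫ y in a..b, (p s).eval y * v y)
      (∫ y in a..b, deriv (fun s => (p s).eval y) t * v y) t := by
    intro a b v hv
    have e1 : ∀ c : ℕ → ℝ, (∫ y in a..b, (∑ i ∈ Finset.range (k + 1), c i * (ℓ i).eval y) * v y) =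
        ∑ i ∈ Finset.range (k + 1), c i * ∫ y in a..b, (ℓ i).eval y * v y := by
      intro c
      simp only [Finset.sum_mul, mul_assoc]
      rw [intervalIntegral.integral_finsetSum]
      · simp only [intervalIntegral.integral_const_mul]
      · intro i _
        exact Continuous.intervalIntegrable (by fun_prop) _ _
    have e2 : (fun s => ∫ y in a..b, (p s).eval y * v y) = fun s =>
        ∑ i ∈ Finset.range (k + 1), (p s).eval (i:ℝ) * ∫ y in a..b, (ℓ i).eval y * v y := by
      ext s
      rw [← e1]
      simp only [← hl _ (hp s)]
    rw [e2]
    simp only [hde]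
    rw [e1]
    exact HasDerivAt.fun_sum fun i _ => ((hD i).mul_const _)
  refine ⟨?_, key, ?_⟩
  · simp only [hde]; fun_prop
  · intro a b
    have e1 : ∀ q : Polynomial ℝ, q.natDegree ≤ k → ∀ v : ℝ → ℝ, Continuous v →
        (∫ y in a..b, v y * q.eval y) =
        ∑ i ∈ Finset.range (k + 1), (∫ y in a..b, v y * (ℓ i).eval y) * q.eval (i:ℝ) := by
      intro q hq v hv
      have : ∀ y, v y * q.eval y = ∑ i ∈ Finset.range (k + 1), (v y * (ℓ i).eval y) * q.eval (i:ℝ) := by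
        intro y
        rw [hl q hq y, Finset.mul_sum]
        exact Finset.sum_congr rfl fun i _ => by ring
      simp only [this]
      rw [intervalIntegral.integral_finsetSum]
      · simp only [intervalIntegral.integral_mul_const]
      · intro i _
        exact Continuous.intervalIntegrable (by fun_prop) _ _
    have e2 : (fun s => ∫ y in a..b, (p s).eval y * (p s).eval y) = fun s =>
        ∑ i ∈ Finset.range (k + 1), (∫ y in a..b, (p s).eval y * (ℓ i).eval y) * (p s).eval (i:ℝ) := by
      ext s
      rw [e1 _ (hp s) _ (p s).continuous]
    have hdc : Continuous (fun y => deriv (fun s => (p s).eval y) t) := by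
      simp only [hde]; fun_prop
    rw [e2, two_mul]
    have h1 := HasDerivAt.fun_sum (u := Finset.range (k + 1)) fun i _ =>
      (key a b (fun y => (ℓ i).eval y) (ℓ i).continuous).fun_mul (hD i)
    refine HasDerivAt.congr_deriv h1 ?_
    rw [Finset.sum_add_distrib]
    congr 1
    · exact (e1 _ (hp t) _ hdc).symm
    · simp only [hde, Finset.sum_mul]
      symm
      rw [intervalIntegral.integral_finsetSum]
      · apply Finset.sum_congr rfl
        intro i _
        rw [← intervalIntegral.integral_mul_const]
        congr 1
        ext y
        ring
      · intro i _
        exact Continuous.intervalIntegrable (by fun_prop) _ _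
/-- Extended correction sequence, with `Fx 0 = -L_k`. -/
noncomputable def Fx (k : ℕ) (a b : ℝ) (F : ℕ → Polynomial ℝ) (i : ℕ) : Polynomial ℝ :=
  if i = 0 then -(LegC k a b) else F i

theorem Dinv_hasDeriv (a b : ℝ) (p : ℝ → ℝ) (hp : Continuous p) (y : ℝ) :
    HasDerivAt (Dinv a b p) (2 / (b - a) * p y) y := by
  unfold Dinv
  exact (intervalIntegral.integral_hasDerivAt_right (hp.intervalIntegrable _ _)
    (hp.stronglyMeasurableAtFilter _ _) hp.continuousAt).const_mul _

theorem Dinv_continuous (a b : ℝ) (p : ℝ → ℝ) (hp : Continuous p) : Continuous (Dinv a b p) :=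
  continuous_iff_continuousAt.2 fun y => (Dinv_hasDeriv a b p hp y).continuousAt

theorem Fx_step (k : ℕ) (a b : ℝ) (F : ℕ → Polynomial ℝ) (hF : IsFSeq k a b F) (i : ℕ) :
    IsGRProj k a b (Dinv a b (fun x => (Fx k a b F i).eval x)) (-(Fx k a b F (i + 1))) := by
  rcases Nat.eq_zero_or_pos i with rfl | hi
  · obtain ⟨h1, h2, h3⟩ := hF.1
    have e : Dinv a b (fun x => (Fx k a b F 0).eval x) =
        fun y => -(Dinv a b (legendreCell k a b) y) := by
      ext y
      simp [Dinv, Fx, legendreCell_eq]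
    rw [e]
    have e2 : Fx k a b F (0 + 1) = F 1 := by simp [Fx]
    rw [e2]
    refine ⟨by simpa using h1, ?_, by simp [h3]⟩
    intro v hv
    have := h2 v hv
    simp only [Polynomial.eval_neg, neg_mul, intervalIntegral.integral_neg, this]
  · have := hF.2 (i + 1) (by omega)
    have e1 : Fx k a b F (i + 1) = F (i + 1) := by simp [Fx]
    have e2 : Fx k a b F i = F i := by simp [Fx, hi.ne']
    rw [e1, e2]
    simpa using this

theorem Fx_deriv (k : ℕ) (hk : 1 ≤ k) (a b : ℝ) (hab : a < b) (F : ℕ → Polynomial ℝ)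
    (hF : IsFSeq k a b F) (i : ℕ) (h0 : (∫ y in a..b, (Fx k a b F i).eval y) = 0) :
    (Fx k a b F (i + 1)).eval b = 0 ∧ ∀ v : Polynomial ℝ, v.natDegree ≤ k →
      (b - a) / 2 * (∫ y in a..b, (Fx k a b F (i + 1)).eval y * v.derivative.eval y) =
        ∫ y in a..b, (Fx k a b F i).eval y * v.eval y := by
  obtain ⟨h1, h2, h3⟩ := Fx_step k a b F hF i
  have hDb : Dinv a b (fun x => (Fx k a b F i).eval x) b = 0 := by simp [Dinv, h0]
  have hDa : Dinv a b (fun x => (Fx k a b F i).eval x) a = 0 := by simp [Dinv]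
  constructor
  · rw [hDb, Polynomial.eval_neg] at h3
    linarith
  · intro v hv
    have h4 := h2 v.derivative (by
      have := Polynomial.natDegree_derivative_le v
      omega)
    have h5 := intervalIntegral.integral_mul_deriv_eq_deriv_mul (a := a) (b := b)
      (fun y _ => Dinv_hasDeriv a b (fun x => (Fx k a b F i).eval x)
        (Polynomial.continuous _) y) (fun y _ => v.hasDerivAt y)
      (Continuous.intervalIntegrable (by fun_prop) _ _)
      (Continuous.intervalIntegrable (by fun_prop) _ _)
    rw [hDa, hDb] at h5
    rw [h5] at h4
    simp only [Polynomial.eval_neg, neg_mul, intervalIntegral.integral_neg, mul_assoc,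
      intervalIntegral.integral_const_mul, zero_mul, sub_zero, zero_sub, neg_inj] at h4
    rw [h4]
    have : b - a ≠ 0 := by linarith
    field_simp

open Polynomial in
theorem exists_antideriv (v : ℝ[X]) : ∃ V : ℝ[X], derivative V = v ∧ V.natDegree ≤ v.natDegree + 1 := by
  refine ⟨∑ i ∈ Finset.range (v.natDegree + 1), C (v.coeff i / (i + 1)) * X ^ (i + 1), ?_, ?_⟩
  · conv_rhs => rw [v.as_sum_range_C_mul_X_pow]
    rw [derivative_sum]
    apply Finset.sum_congr rfl
    intro i _
    rw [derivative_C_mul_X_pow]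
    simp only [Nat.add_sub_cancel]
    congr 2
    have : (i:ℝ) + 1 ≠ 0 := by positivity
    push_cast
    field_simp
  · apply natDegree_sum_le_of_forall_le
    intro i hi
    refine (natDegree_C_mul_X_pow_le _ _).trans ?_
    have := Finset.mem_range.1 hi
    omega

theorem Fx_orth (k : ℕ) (hk : 1 ≤ k) (a b : ℝ) (hab : a < b) (F : ℕ → Polynomial ℝ)
    (hF : IsFSeq k a b F) (i : ℕ) (v : Polynomial ℝ) (hv : v.natDegree + i < k) :
    (∫ y in a..b, (Fx k a b F i).eval y * v.eval y) = 0 := by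
  induction i generalizing v with
  | zero =>
    have := LegC_orth k a b hab v (by omega)
    simp [Fx, this]
  | succ i ih =>
    obtain ⟨V, hV, hVd⟩ := exists_antideriv v
    have h0 : (∫ y in a..b, (Fx k a b F i).eval y) = 0 := by
      have := ih 1 (by simp; omega)
      simpa using this
    have h1 := (Fx_deriv k hk a b hab F hF i h0).2 V (by omega)
    rw [ih V (by omega), hV] at h1
    have : (b - a) / 2 ≠ 0 := by intro h; linarith
    exact (mul_eq_zero.1 h1).resolve_left this

theorem Fx_mean (k : ℕ) (hk : 1 ≤ k) (a b : ℝ) (hab : a < b) (F : ℕ → Polynomial ℝ)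
    (hF : IsFSeq k a b F) (i : ℕ) (hi : i < k) :
    (∫ y in a..b, (Fx k a b F i).eval y) = 0 := by
  have := Fx_orth k hk a b hab F hF i 1 (by simpa using hi)
  simpa using this

theorem gr_unique (k : ℕ) (a b : ℝ) (hab : a < b) (u : ℝ → ℝ) (hu : Continuous u)
    (P Q : Polynomial ℝ) (hP : IsGRProj k a b u P) (hQ : IsGRProj k a b u Q) : P = Q := by
  apply Polynomial.funext
  intro y
  rw [gr_eval k a b hab u hu P hP, gr_eval k a b hab u hu Q hQ]

theorem F_unique (k : ℕ) (a b : ℝ) (hab : a < b) (F F' : ℕ → Polynomial ℝ)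
    (hF : IsFSeq k a b F) (hF' : IsFSeq k a b F') (i : ℕ) (hi : 1 ≤ i) : F i = F' i := by
  induction i, hi using Nat.le_induction with
  | base =>
    refine gr_unique k a b hab _ (Dinv_continuous _ _ _ ?_) _ _ hF.1 hF'.1
    have : legendreCell k a b = fun y => (LegC k a b).eval y := by
      ext y; exact legendreCell_eq k a b y
    rw [this]; fun_prop
  | succ i hi ih =>
    have h1 := hF.2 (i + 1) (by omega)
    have h2 := hF'.2 (i + 1) (by omega)
    simp only [Nat.add_sub_cancel] at h1 h2
    rw [← ih] at h2
    exact neg_injective (gr_unique k a b hab _ (Dinv_continuous _ _ _ (by fun_prop)) _ _ h1 h2)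

theorem int_change01 (f : ℝ → ℝ) (a b : ℝ) (hab : a < b) (s : ℝ) :
    (∫ y in a..((b - a) * s + a), f y) = (b - a) * ∫ r in (0:ℝ)..s, f ((b - a) * r + a) := by
  have h0 : (b - a) ≠ 0 := by intro h; linarith
  rw [intervalIntegral.integral_comp_mul_add f h0]
  rw [smul_eq_mul, ← mul_assoc, mul_inv_cancel₀ h0, one_mul]
  congr 1; ring

theorem int_change01' (f : ℝ → ℝ) (a b : ℝ) (hab : a < b) :
    (∫ y in a..b, f y) = (b - a) * ∫ r in (0:ℝ)..1, f ((b - a) * r + a) := by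
  rw [← int_change01 f a b hab 1]; congr 1; ring

theorem Dinv_scale (f : ℝ → ℝ) (a b : ℝ) (hab : a < b) (s : ℝ) :
    Dinv a b f ((b - a) * s + a) = Dinv 0 1 (fun r => f ((b - a) * r + a)) s := by
  unfold Dinv
  rw [int_change01 f a b hab s]
  have h0 : (b - a) ≠ 0 := by intro h; linarith
  field_simp
  simp

open Polynomial in
theorem gr_scale (k : ℕ) (a b : ℝ) (hab : a < b) (u : ℝ → ℝ) (P : ℝ[X]) (hP : IsGRProj k a b u P) :
    IsGRProj k 0 1 (fun s => u ((b - a) * s + a)) (P.comp (C (b - a) * X + C a)) := by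
  obtain ⟨h1, h2, h3⟩ := hP
  have h0 : (b - a) ≠ 0 := by intro h; linarith
  refine ⟨(natDegree_comp_affine_le _ _ _).trans h1, ?_, by simp [eval_comp, h3]⟩
  intro v hv
  have := h2 (v.comp (C (1 / (b - a)) * X + C (-a / (b - a)))) (by
    have := natDegree_comp_affine_le v (1 / (b - a)) (-a / (b - a))
    omega)
  rw [int_change01' _ a b hab, int_change01' _ a b hab] at this
  have := mul_left_cancel₀ h0 this
  have e : ∀ r : ℝ, 1 / (b - a) * ((b - a) * r + a) + -a / (b - a) = r := by
    intro r; field_simp; ring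
  simp only [eval_comp, eval_add, eval_mul, eval_C, eval_X, e] at this ⊢
  exact this

open Polynomial in
theorem F_scale (k : ℕ) (a b : ℝ) (hab : a < b) (F : ℕ → ℝ[X]) (hF : IsFSeq k a b F) :
    IsFSeq k 0 1 (fun i => (F i).comp (C (b - a) * X + C a)) := by
  have h0 : (b - a) ≠ 0 := by intro h; linarith
  constructor
  · have := gr_scale k a b hab _ _ hF.1
    simp only [Dinv_scale _ a b hab] at this
    have e : (fun r => legendreCell k a b ((b - a) * r + a)) = legendreCell k 0 1 := by
      ext r
      unfold legendreCell
      congr 1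
      field_simp
      ring
    rw [e] at this
    exact this
  · intro i hi
    have := gr_scale k a b hab _ _ (hF.2 i hi)
    simp only [Dinv_scale _ a b hab] at this
    simp only [neg_comp] at this
    simpa only [eval_comp, eval_add, eval_mul, eval_C, eval_X] using this

open Polynomial in
theorem F_bound (k : ℕ) (hk : 1 ≤ k) : ∃ B : ℝ, 0 ≤ B ∧ ∀ a b : ℝ, a < b → ∀ F : ℕ → ℝ[X],
    IsFSeq k a b F → ∀ y ∈ Set.Icc a b, |(F k).eval y| ≤ B := by
  by_cases h : ∃ F, IsFSeq k 0 1 F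
  · obtain ⟨F0, hF0⟩ := h
    obtain ⟨S, hS⟩ := (isCompact_Icc (a := (0:ℝ)) (b := 1)).exists_bound_of_continuousOn
      (F0 k).continuous.continuousOn
    refine ⟨S, (norm_nonneg _).trans (hS 0 (by norm_num)), ?_⟩
    intro a b hab F hF y hy
    have hba : 0 < b - a := by linarith
    have e := F_unique k 0 1 (by norm_num) _ _ (F_scale k a b hab F hF) hF0 k hk
    have := hS ((y - a) / (b - a)) ⟨div_nonneg (by linarith [hy.1]) hba.le, by
      rw [div_le_one hba]; linarith [hy.2]⟩
    rw [← e, eval_comp] at this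
    simp only [eval_add, eval_mul, eval_C, eval_X] at this
    rw [mul_div_cancel₀ _ hba.ne', sub_add_cancel] at this
    exact this
  · refine ⟨0, le_rfl, ?_⟩
    intro a b hab F hF
    exact absurd ⟨_, F_scale k a b hab F hF⟩ h
/-- The interpolant `u_I^k` as a polynomial-valued curve. -/
noncomputable def Uc (k : ℕ) (a b : ℝ) (u0 : ℝ → ℝ) (P : ℝ → Polynomial ℝ)
    (F : ℕ → Polynomial ℝ) (s : ℝ) : Polynomial ℝ :=
  P s - ∑ i ∈ Finset.range k,
    Polynomial.C (((b - a) / 2) ^ (i + 1) * Gfun k a b u0 (i + 1) s) * Fx k a b F (i + 1)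

theorem Uc_eval (k : ℕ) (a b : ℝ) (u0 : ℝ → ℝ) (P : ℝ → Polynomial ℝ)
    (F : ℕ → Polynomial ℝ) (s y : ℝ) :
    (Uc k a b u0 P F s).eval y = (P s).eval y - ∑ i ∈ Finset.range k,
      (((b - a) / 2) ^ (i + 1) * Gfun k a b u0 (i + 1) s) * (Fx k a b F (i + 1)).eval y := by
  simp [Uc, Polynomial.eval_finsetSum]

theorem Uc_eq_uIl (k : ℕ) (a b : ℝ) (u0 : ℝ → ℝ) (P : ℝ → Polynomial ℝ)
    (F : ℕ → Polynomial ℝ) (s y : ℝ) :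
    (Uc k a b u0 P F s).eval y = uIl k a b u0 P F k y s := by
  rw [Uc_eval]
  unfold uIl wSum wFun
  congr 1
  rw [show Finset.Icc 1 k = Finset.Ico 1 (k + 1) from by ext; simp,
    Finset.sum_Ico_eq_sum_range]
  simp only [Nat.add_sub_cancel]
  apply Finset.sum_congr rfl
  intro i _
  rw [add_comm 1 i]
  simp [Fx]

theorem Fx_natDegree (k : ℕ) (a b : ℝ) (F : ℕ → Polynomial ℝ) (hF : IsFSeq k a b F)
    (i : ℕ) : (Fx k a b F i).natDegree ≤ k := by
  cases i with
  | zero => simpa [Fx] using LegC_natDegree_le k a b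
  | succ i => simpa using (Fx_step k a b F hF i).1

theorem Uc_natDegree (k : ℕ) (a b : ℝ) (u0 : ℝ → ℝ) (P : ℝ → Polynomial ℝ) (hP : ∀ t, IsGRProj k a b (fun y => u0 (y - t)) (P t)) (F : ℕ → Polynomial ℝ) (hF : IsFSeq k a b F)
    (s : ℝ) : (Uc k a b u0 P F s).natDegree ≤ k := by
  refine (Polynomial.natDegree_sub_le _ _).trans (max_le (hP s).1 ?_)
  apply Polynomial.natDegree_sum_le_of_forall_le
  intro i _
  exact (Polynomial.natDegree_C_mul_le _ _).trans (Fx_natDegree k a b F hF _)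

theorem Uc_diff (k : ℕ) (a b : ℝ) (hab : a < b) (u0 : ℝ → ℝ) (hu : ContDiff ℝ ((2 * k + 2 : ℕ) : WithTop ℕ∞) u0) (P : ℝ → Polynomial ℝ) (hP : ∀ t, IsGRProj k a b (fun y => u0 (y - t)) (P t)) (F : ℕ → Polynomial ℝ)
    (t y : ℝ) : DifferentiableAt ℝ (fun s => (Uc k a b u0 P F s).eval y) t := by
  have h1 : ContDiff ℝ 1 u0 := hu.of_le (by exact_mod_cast (by omega : 1 ≤ 2 * k + 2))
  have hc := h1.continuous
  simp only [Uc_eval]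
  apply DifferentiableAt.sub
  · have e : (fun s => (P s).eval y) = fun s => (∑ l ∈ Finset.range (k + 1),
      ((2 * (l:ℝ) + 1) / (b - a) * ∫ y in a..b, u0 (y - s) * (LegC l a b).eval y) *
        (LegC l a b).eval y) + radauCoeff a b (fun y => u0 (y - s)) (k + 1) * (LegC k a b).eval y := by
      ext s
      exact gr_eval k a b hab (fun y => u0 (y - s)) (by fun_prop) (P s) (hP s) y
    rw [e]
    apply DifferentiableAt.add
    · apply DifferentiableAt.fun_sum
      intro l _
      exact ((hasDerivAt_conv u0 _ h1 (LegC l a b).continuous a b t).differentiableAt.const_mul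
        _).mul_const _
    · exact (hasDerivAt_radau u0 h1 a b t (k + 1)).differentiableAt.mul_const _
  · apply DifferentiableAt.fun_sum
    intro i hi
    have := Finset.mem_range.1 hi
    exact ((G_hasDeriv k a b u0 _ hu (i + 1) (by omega) t).differentiableAt.const_mul _).mul_const _

theorem Uc_int (k : ℕ) (a b : ℝ) (u0 : ℝ → ℝ) (P : ℝ → Polynomial ℝ) (F : ℕ → Polynomial ℝ)
    (s : ℝ) (q : ℝ → ℝ) (hq : Continuous q) :
    (∫ y in a..b, (Uc k a b u0 P F s).eval y * q y) = (∫ y in a..b, (P s).eval y * q y) -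
      ∑ i ∈ Finset.range k, (((b - a) / 2) ^ (i + 1) * Gfun k a b u0 (i + 1) s) *
        ∫ y in a..b, (Fx k a b F (i + 1)).eval y * q y := by
  simp only [Uc_eval, sub_mul, Finset.sum_mul]
  rw [intervalIntegral.integral_sub (Continuous.intervalIntegrable (by fun_prop) _ _)
    (Continuous.intervalIntegrable (by fun_prop) _ _)]
  rw [intervalIntegral.integral_finsetSum]
  · simp only [mul_assoc, intervalIntegral.integral_const_mul]
  · intro i _
    exact Continuous.intervalIntegrable (by fun_prop) _ _

theorem Uc_test (k : ℕ) (a b : ℝ) (hab : a < b) (u0 : ℝ → ℝ) (hu : ContDiff ℝ ((2 * k + 2 : ℕ) : WithTop ℕ∞) u0) (P : ℝ → Polynomial ℝ) (hP : ∀ t, IsGRProj k a b (fun y => u0 (y - t)) (P t)) (F : ℕ → Polynomial ℝ)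
    (s : ℝ) (v : Polynomial ℝ) (hv : v.natDegree ≤ k) :
    (∫ y in a..b, (Uc k a b u0 P F s).eval y * v.eval y) = (∫ y in a..b, u0 (y - s) * v.eval y) -
      ∑ i ∈ Finset.range (k + 1), (((b - a) / 2) ^ i * Gfun k a b u0 i s) *
        ∫ y in a..b, (Fx k a b F i).eval y * v.eval y := by
  have hc := hu.continuous
  rw [Uc_int _ _ _ _ _ _ _ _ v.continuous, gr_test k a b hab _ (by fun_prop) _ (hP s) v hv,
    Finset.sum_range_succ']
  have e1 : Gfun k a b u0 0 s = radauCoeff a b (fun y => u0 (y - s)) (k + 1) := by simp [Gfun]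
  have e2 : (∫ y in a..b, (Fx k a b F 0).eval y * v.eval y) =
      -∫ y in a..b, (LegC k a b).eval y * v.eval y := by simp [Fx]
  rw [e1, e2]
  ring

theorem Uc_right (k : ℕ) (hk : 1 ≤ k) (a b : ℝ) (hab : a < b) (u0 : ℝ → ℝ) (P : ℝ → Polynomial ℝ) (hP : ∀ t, IsGRProj k a b (fun y => u0 (y - t)) (P t)) (F : ℕ → Polynomial ℝ) (hF : IsFSeq k a b F)
    (s : ℝ) : (Uc k a b u0 P F s).eval b = u0 (b - s) := by
  rw [Uc_eval, (hP s).2.2, Finset.sum_eq_zero, sub_zero]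
  intro i hi
  rw [(Fx_deriv k hk a b hab F hF i
    (Fx_mean k hk a b hab F hF i (Finset.mem_range.1 hi))).1, mul_zero]

theorem Uc_mean (k : ℕ) (hk : 1 ≤ k) (a b : ℝ) (hab : a < b) (u0 : ℝ → ℝ) (hu : ContDiff ℝ ((2 * k + 2 : ℕ) : WithTop ℕ∞) u0) (P : ℝ → Polynomial ℝ) (hP : ∀ t, IsGRProj k a b (fun y => u0 (y - t)) (P t)) (F : ℕ → Polynomial ℝ) (hF : IsFSeq k a b F)
    (s : ℝ) :
    (∫ y in a..b, (u0 (y - s) - (Uc k a b u0 P F s).eval y)) =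
      ∫ y in a..b, ((b - a) / 2) ^ k * Gfun k a b u0 k s * (F k).eval y := by
  have hc := hu.continuous
  have h := Uc_test k a b hab u0 hu P hP F s 1 (by simp)
  simp only [Polynomial.eval_one, mul_one] at h
  rw [Finset.sum_range_succ, Finset.sum_eq_zero, zero_add] at h
  · rw [intervalIntegral.integral_sub (Continuous.intervalIntegrable (by fun_prop) _ _)
      (Continuous.intervalIntegrable (by fun_prop) _ _), h, intervalIntegral.integral_const_mul]
    have : Fx k a b F k = F k := by simp [Fx]; omega
    rw [this]; ring
  · intro i hi
    rw [Fx_mean k hk a b hab F hF i (Finset.mem_range.1 hi), mul_zero]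

theorem Uc_weak (k : ℕ) (hk : 1 ≤ k) (a b : ℝ) (hab : a < b) (u0 : ℝ → ℝ) (hu : ContDiff ℝ ((2 * k + 2 : ℕ) : WithTop ℕ∞) u0) (P : ℝ → Polynomial ℝ) (hP : ∀ t, IsGRProj k a b (fun y => u0 (y - t)) (P t)) (F : ℕ → Polynomial ℝ) (hF : IsFSeq k a b F)
    (t : ℝ) (v : Polynomial ℝ) (hv : v.natDegree ≤ k) :
    (∫ y in a..b, deriv (fun s => (Uc k a b u0 P F s).eval y) t * v.eval y)
      - (∫ y in a..b, (Uc k a b u0 P F t).eval y * v.derivative.eval y)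
      + (Uc k a b u0 P F t).eval b * v.eval b - u0 (a - t) * v.eval a
      = -∫ y in a..b, (((b - a) / 2) ^ k * Gfun k a b u0 (k + 1) t * (F k).eval y) * v.eval y := by
  have h1 : ContDiff ℝ 1 u0 := hu.of_le (by exact_mod_cast (by omega : 1 ≤ 2 * k + 2))
  have hc := h1.continuous
  have hc' : Continuous (deriv u0) := h1.continuous_deriv le_rfl
  -- time derivative
  have hA := (poly_curve k (Uc k a b u0 P F) (Uc_natDegree k a b u0 P hP F hF) t
    (Uc_diff k a b hab u0 hu P hP F t)).2.1 a b (fun y => v.eval y) v.continuous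
  have hB := (hasDerivAt_conv u0 _ h1 v.continuous a b t).sub
    (HasDerivAt.fun_sum (u := Finset.range (k + 1)) (fun i hi =>
      ((G_hasDeriv k a b u0 _ hu i (by have := Finset.mem_range.1 hi; omega) t).const_mul
        (((b - a) / 2) ^ i)).mul_const (∫ y in a..b, (Fx k a b F i).eval y * v.eval y)))
  have e : (fun s => ∫ y in a..b, (Uc k a b u0 P F s).eval y * v.eval y) = _ :=
    funext fun s => Uc_test k a b hab u0 hu P hP F s v hv
  rw [e] at hA
  have hT := hA.unique hB
  rw [hT]
  -- space term
  have hS : (∫ y in a..b, (Uc k a b u0 P F t).eval y * v.derivative.eval y) =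
      (∫ y in a..b, u0 (y - t) * v.derivative.eval y) -
      ∑ i ∈ Finset.range k, (((b - a) / 2) ^ i * Gfun k a b u0 (i + 1) t) *
        ∫ y in a..b, (Fx k a b F i).eval y * v.eval y := by
    rw [Uc_int _ _ _ _ _ _ _ _ v.derivative.continuous]
    rw [(hP t).2.1 v.derivative (by
      have := Polynomial.natDegree_derivative_le v
      omega)]
    congr 1
    apply Finset.sum_congr rfl
    intro i hi
    rw [← (Fx_deriv k hk a b hab F hF i
      (Fx_mean k hk a b hab F hF i (Finset.mem_range.1 hi))).2 v hv]
    ring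
  have hI := intervalIntegral.integral_mul_deriv_eq_deriv_mul (a := a) (b := b)
      (u := fun y => u0 (y - t)) (u' := fun y => deriv u0 (y - t))
      (fun y _ => by
        have := ((h1.differentiable one_ne_zero) (y - t)).hasDerivAt.comp_sub_const y t
        exact this) (fun y _ => v.hasDerivAt y)
      (Continuous.intervalIntegrable (by fun_prop) _ _)
      (Continuous.intervalIntegrable (by fun_prop) _ _)
  rw [hS, hI, Uc_right k hk a b hab u0 P hP F hF, Finset.sum_range_succ]
  have : Fx k a b F k = F k := by simp [Fx]; omega
  rw [this]
  simp only [mul_assoc, intervalIntegral.integral_const_mul]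
  ring

/-- Local energy inequality. -/
theorem cell_energy (k : ℕ) (hk : 1 ≤ k) (a b : ℝ) (hab : a < b) (u0 : ℝ → ℝ) (hu : ContDiff ℝ ((2 * k + 2 : ℕ) : WithTop ℕ∞) u0) (P : ℝ → Polynomial ℝ) (hP : ∀ t, IsGRProj k a b (fun y => u0 (y - t)) (P t)) (F : ℕ → Polynomial ℝ) (hF : IsFSeq k a b F)
    (uh : ℝ → Polynomial ℝ) (huh : ∀ s, (uh s).natDegree ≤ k)
    (huc : ∀ y, ContDiff ℝ 1 (fun t => (uh t).eval y)) (t β R : ℝ)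
    (hdg : ∀ v : Polynomial ℝ, v.natDegree ≤ k →
      (∫ y in a..b, deriv (fun s => (uh s).eval y) t * v.eval y)
      - (∫ y in a..b, (uh t).eval y * v.derivative.eval y)
      + (uh t).eval b * v.eval b - β * v.eval a = 0)
    (hR : ∀ y ∈ Set.Icc a b, |((b - a) / 2) ^ k * Gfun k a b u0 (k + 1) t * (F k).eval y| ≤ R) :
    ∃ e' : ℝ, HasDerivAt (fun s => ∫ y in a..b, (Uc k a b u0 P F s - uh s).eval y *
        (Uc k a b u0 P F s - uh s).eval y) e' t ∧
      ∀ lam : ℝ, 0 ≤ lam → lam * e' ≤ lam * ((u0 (a - t) - β) ^ 2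
          - ((Uc k a b u0 P F t - uh t).eval b) ^ 2) + lam ^ 2 * (R ^ 2 * (b - a)) +
        ∫ y in a..b, (Uc k a b u0 P F t - uh t).eval y * (Uc k a b u0 P F t - uh t).eval y := by
  have hUd := Uc_natDegree k a b u0 P hP F hF
  have hUdiff := Uc_diff k a b hab u0 hu P hP F t
  have hud : ∀ y, DifferentiableAt ℝ (fun s => (uh s).eval y) t :=
    fun y => ((huc y).differentiable one_ne_zero) t
  set U := Uc k a b u0 P F with hUdef
  have hxd : ∀ s, (U s - uh s).natDegree ≤ k := fun s =>
    (Polynomial.natDegree_sub_le _ _).trans (max_le (hUd s) (huh s))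
  have hder : ∀ y, deriv (fun s => (U s - uh s).eval y) t =
      deriv (fun s => (U s).eval y) t - deriv (fun s => (uh s).eval y) t := by
    intro y
    simp only [Polynomial.eval_sub]
    exact deriv_fun_sub (hUdiff y) (hud y)
  have hdiff : ∀ y, DifferentiableAt ℝ (fun s => (U s - uh s).eval y) t := by
    intro y
    simp only [Polynomial.eval_sub]
    exact (hUdiff y).sub (hud y)
  have hcU := (poly_curve k U hUd t hUdiff).1
  have hcu := (poly_curve k uh huh t hud).1
  refine ⟨_, (poly_curve k (fun s => U s - uh s) hxd t hdiff).2.2 a b, ?_⟩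
  intro lam hlam
  have hw := Uc_weak k hk a b hab u0 hu P hP F hF t (U t - uh t) (hxd t)
  have hd := hdg (U t - uh t) (hxd t)
  rw [← hUdef] at hw
  set x := U t - uh t with hx
  have hsplit : (∫ y in a..b, deriv (fun s => (U s - uh s).eval y) t * x.eval y) =
      (∫ y in a..b, deriv (fun s => (U s).eval y) t * x.eval y) -
      ∫ y in a..b, deriv (fun s => (uh s).eval y) t * x.eval y := by
    rw [← intervalIntegral.integral_sub (Continuous.intervalIntegrable (by fun_prop) _ _)
      (Continuous.intervalIntegrable (by fun_prop) _ _)]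
    congr 1
    ext y
    rw [hder]; ring
  have hsplit2 : (∫ y in a..b, x.eval y * x.derivative.eval y) =
      (∫ y in a..b, (U t).eval y * x.derivative.eval y) -
      ∫ y in a..b, (uh t).eval y * x.derivative.eval y := by
    rw [← intervalIntegral.integral_sub (Continuous.intervalIntegrable (by fun_prop) _ _)
      (Continuous.intervalIntegrable (by fun_prop) _ _)]
    congr 1
    ext y
    rw [hx, Polynomial.eval_sub]; ring
  have hibp := poly_ibp x x a b
  have hsym : (∫ y in a..b, x.derivative.eval y * x.eval y) =
    ∫ y in a..b, x.eval y * x.derivative.eval y := by simp only [mul_comm]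
  have hxb : x.eval b = (U t).eval b - (uh t).eval b := by rw [hx, Polynomial.eval_sub]
  -- the residual
  set f : ℝ → ℝ := fun y => ((b - a) / 2) ^ k * Gfun k a b u0 (k + 1) t * (F k).eval y with hf
  have hfc : Continuous f := by fun_prop
  have hres : 0 ≤ lam ^ 2 * (R ^ 2 * (b - a)) + 2 * lam * (∫ y in a..b, f y * x.eval y)
      + ∫ y in a..b, x.eval y * x.eval y := by
    have h1 : (∫ y in a..b, (lam ^ 2 * R ^ 2 + (2 * lam * (f y * x.eval y) + x.eval y * x.eval y)))
        = lam ^ 2 * (R ^ 2 * (b - a)) + 2 * lam * (∫ y in a..b, f y * x.eval y)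
      + ∫ y in a..b, x.eval y * x.eval y := by
      rw [intervalIntegral.integral_add (Continuous.intervalIntegrable (by fun_prop) _ _)
        (Continuous.intervalIntegrable (by fun_prop) _ _),
        intervalIntegral.integral_add (Continuous.intervalIntegrable (by fun_prop) _ _)
        (Continuous.intervalIntegrable (by fun_prop) _ _), intervalIntegral.integral_const, smul_eq_mul,
        intervalIntegral.integral_const_mul]
      ring
    rw [← h1]
    apply intervalIntegral.integral_nonneg hab.le
    intro y hy
    have h2 : f y ^ 2 ≤ R ^ 2 := sq_le_sq' (by linarith [neg_abs_le (f y), hR y hy])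
      ((le_abs_self _).trans (hR y hy))
    have h3 := mul_le_mul_of_nonneg_left h2 (sq_nonneg lam)
    nlinarith [sq_nonneg (lam * f y + x.eval y)]
  have heq : 2 * (∫ y in a..b, deriv (fun s => (U s - uh s).eval y) t * x.eval y) =
      -(x.eval b) ^ 2 - (x.eval a) ^ 2 + 2 * (u0 (a - t) - β) * x.eval a
        - 2 * ∫ y in a..b, f y * x.eval y := by
    rw [hsplit]
    rw [hsym] at hibp
    have h5 : x.eval b * x.eval b = (U t).eval b * x.eval b - (uh t).eval b * x.eval b := by
      rw [← sub_mul, ← hxb]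
    linear_combination 2 * hw - 2 * hd + hibp - 2 * hsplit2 + 2 * h5
  rw [heq]
  have h6 : 0 ≤ lam * (u0 (a - t) - β - x.eval a) ^ 2 := by positivity
  nlinarith

theorem energy_growth (E : ℝ → ℝ) (t Q : ℝ) (ht : 0 ≤ t) (hQ : 0 ≤ Q) (hE0 : E 0 = 0)
    (hE : ∀ s ∈ Set.Icc 0 t, ∃ e' : ℝ, HasDerivAt E e' s ∧
      ∀ lam : ℝ, 0 ≤ lam → lam * e' ≤ lam ^ 2 * Q + E s) : E t ≤ 4 * t ^ 2 * Q := by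
  rcases ht.eq_or_lt with h0 | h0
  · rw [← h0, hE0]; simp
  choose! e' he' hle using hE
  have hd : ∀ s ∈ Set.Icc 0 t, HasDerivAt (fun s => (2 * t - s) * E s - 4 * t ^ 2 * Q * s)
      (-1 * E s + (2 * t - s) * e' s - 4 * t ^ 2 * Q) s := by
    intro s hs
    have h1 : HasDerivAt (fun s => 2 * t - s) (-1) s := by
      simpa using (hasDerivAt_id s).const_sub (2 * t)
    have h2 : HasDerivAt (fun s => 4 * t ^ 2 * Q * s) (4 * t ^ 2 * Q) s := by
      simpa using (hasDerivAt_id s).const_mul (4 * t ^ 2 * Q)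
    exact (h1.mul (he' s hs)).sub h2
  have ha : AntitoneOn (fun s => (2 * t - s) * E s - 4 * t ^ 2 * Q * s) (Set.Icc 0 t) := by
    apply antitoneOn_of_deriv_nonpos (convex_Icc 0 t)
    · exact fun s hs => (hd s hs).continuousAt.continuousWithinAt
    · intro s hs
      exact (hd s (interior_subset hs)).differentiableAt.differentiableWithinAt
    · intro s hs
      have hs' := interior_subset hs
      rw [(hd s hs').deriv]
      have h3 := hle s hs' (2 * t - s) (by linarith [hs'.2])
      have h4 : (2 * t - s) ^ 2 ≤ 4 * t ^ 2 := by nlinarith [hs'.1, hs'.2]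
      have h5 := mul_le_mul_of_nonneg_right h4 hQ
      linarith
  have h6 := ha (Set.left_mem_Icc.2 ht) (Set.right_mem_Icc.2 ht) ht
  simp only [hE0] at h6
  have h7 : t * E t ≤ t * (4 * t ^ 2 * Q) := by linarith
  exact le_of_mul_le_mul_left h7 h0

theorem final_bound (k : ℕ) (K h c t M : ℝ) (hK : 0 ≤ K) (hh : 0 ≤ h)
    (hhc : h ≤ 2 * Real.pi * c) (ht : 0 ≤ t) (hM : 0 ≤ M) :
    K * h ^ (2 * k + 1) * M * (1 + 2 * t) ≤
      (K + 1) * (2 + Real.sqrt (2 * Real.pi * c)) * (Real.sqrt h + t ^ 2) *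
        h ^ (2 * (k:ℝ) + 1 / 2) * M := by
  have hs := Real.sqrt_nonneg h
  have e : h ^ (2 * k + 1) = Real.sqrt h * h ^ (2 * (k:ℝ) + 1 / 2) := by
    rw [Real.sqrt_eq_rpow, ← Real.rpow_add_of_nonneg hh (by positivity) (by positivity),
      ← Real.rpow_natCast]
    congr 1
    push_cast; ring
  set p := h ^ (2 * (k:ℝ) + 1 / 2) with hp
  have hp0 : 0 ≤ p := Real.rpow_nonneg hh _
  have hsq : Real.sqrt h ≤ Real.sqrt (2 * Real.pi * c) := Real.sqrt_le_sqrt hhc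
  set q := Real.sqrt (2 * Real.pi * c)
  set r := Real.sqrt h
  have h1 : r * (1 + 2 * t) ≤ (2 + q) * (r + t ^ 2) := by
    nlinarith [mul_nonneg hs (sq_nonneg (t - 1)), mul_nonneg (sub_nonneg.2 hsq) (sq_nonneg t),
      sq_nonneg t, mul_nonneg hs (hs.trans hsq)]
  rw [e]
  have h2 : K * (r * (1 + 2 * t)) ≤ (K + 1) * ((2 + q) * (r + t ^ 2)) :=
    mul_le_mul (by linarith) h1 (by positivity) (by linarith)
  have h3 := mul_le_mul_of_nonneg_right h2 (mul_nonneg hp0 hM)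
  linarith

theorem res_bound (k : ℕ) (hk : 1 ≤ k) : ∃ K : ℝ, 0 ≤ K ∧
    ∀ a b h : ℝ, a < b → b - a ≤ h → ∀ u0 : ℝ → ℝ,
      ContDiff ℝ ((2 * k + 2 : ℕ) : WithTop ℕ∞) u0 →
      ∀ F, IsFSeq k a b F → ∀ i ≤ k + 1, ∀ M t, 0 ≤ M →
      (∀ j ≤ 2 * k + 2, ∀ y ∈ Set.Icc a b, |iteratedDeriv j u0 (y - t)| ≤ M) →
      ∀ y ∈ Set.Icc a b, |((b - a) / 2) ^ k * Gfun k a b u0 i t * (F k).eval y| ≤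
        K * h ^ (2 * k + 1) * M := by
  obtain ⟨K, hK, hG⟩ := G_bound k
  obtain ⟨B, hB, hFb⟩ := F_bound k hk
  refine ⟨K * B, by positivity, ?_⟩
  intro a b h hab hh u0 hu F hF i hi M t hM hm y hy
  have h1 := hG a b hab u0 hu i hi M t hm
  have h2 := hFb a b hab F hF y hy
  have h0 : 0 < b - a := by linarith
  have h3 : ((b - a) / 2) ^ k ≤ h ^ k := pow_le_pow_left₀ (by linarith) (by linarith) k
  have h4 : (b - a) ^ (k + 1) ≤ h ^ (k + 1) := pow_le_pow_left₀ (by linarith) (by linarith) _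
  have hh0 : 0 ≤ h := by linarith
  rw [abs_mul, abs_mul, abs_of_nonneg (by positivity : (0:ℝ) ≤ ((b - a) / 2) ^ k)]
  calc ((b - a) / 2) ^ k * |Gfun k a b u0 i t| * |(F k).eval y|
      ≤ h ^ k * (K * h ^ (k + 1) * M) * B := by
        have h5 : |Gfun k a b u0 i t| ≤ K * h ^ (k + 1) * M := h1.trans (by gcongr)
        gcongr
    _ = K * B * h ^ (2 * k + 1) * M := by ring

theorem sum_Icc_one (N : ℕ) (f : ℕ → ℝ) :
    ∑ j ∈ Finset.Icc 1 N, f j = ∑ m ∈ Finset.range N, f (m + 1) := by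
  rw [show Finset.Icc 1 N = Finset.Ico 1 (N + 1) from by ext; simp,
    Finset.sum_Ico_eq_sum_range]
  simp [add_comm]

theorem mean_le (q : Polynomial ℝ) (a b mu : ℝ) (hab : a ≤ b) :
    2 * mu * (∫ y in a..b, q.eval y) ≤ (∫ y in a..b, q.eval y * q.eval y) + mu ^ 2 * (b - a) := by
  have h : 0 ≤ ∫ y in a..b, (q.eval y * q.eval y + (-(2 * mu)) * q.eval y + mu ^ 2) := by
    apply intervalIntegral.integral_nonneg hab
    intro y _
    nlinarith [sq_nonneg (q.eval y - mu)]
  rw [intervalIntegral.integral_add (Continuous.intervalIntegrable (by fun_prop) _ _)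
      (Continuous.intervalIntegrable (by fun_prop) _ _),
    intervalIntegral.integral_add (Continuous.intervalIntegrable (by fun_prop) _ _)
      (Continuous.intervalIntegrable (by fun_prop) _ _), intervalIntegral.integral_const,
    smul_eq_mul, intervalIntegral.integral_const_mul] at h
  linarith

/-- superconvergence of the domain average, Dirichlet boundary condition:
`|(1/2π) ∫_0^{2π} (u - u_h)(x,t) dx| ≤ C (h^{1/2} + t²) h^{2k+1/2} M_{2k+2}`. -/
theorem stmt15 (k : ℕ) (hk : 1 ≤ k) (c : ℝ) (hc : 1 ≤ c) :
    ∃ C : ℝ, 0 < C ∧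
      ∀ (N : ℕ) (x : ℕ → ℝ) (h T : ℝ), 1 ≤ N → x 0 = 0 → x N = 2 * Real.pi →
        (∀ j < N, x j < x (j+1)) →
        (∀ j ∈ Finset.Icc 1 N, x j - x (j-1) ≤ h) →
        (∀ j ∈ Finset.Icc 1 N, h ≤ c * (x j - x (j-1))) →
        0 < T →
        ∀ u0 : ℝ → ℝ, ContDiff ℝ (2*k+2) u0 →
        ∀ M : ℝ,
          (∀ i ≤ 2*k+2, ∀ y ∈ Set.Icc (-T) (2 * Real.pi), |iteratedDeriv i u0 y| ≤ M) →
        ∀ P : ℕ → ℝ → Polynomial ℝ,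
          (∀ j ∈ Finset.Icc 1 N, ∀ t : ℝ,
            IsGRProj k (x (j-1)) (x j) (fun y => u0 (y - t)) (P j t)) →
        ∀ F : ℕ → ℕ → Polynomial ℝ,
          (∀ j ∈ Finset.Icc 1 N, IsFSeq k (x (j-1)) (x j) (F j)) →
        ∀ (inflow : ℝ → ℝ) (uh : ℕ → ℝ → Polynomial ℝ),
          IsDGSol k N x T inflow uh →
          (∀ t, inflow t = u0 (-t)) →
          (∀ j ∈ Finset.Icc 1 N, ∀ y ∈ Set.Icc (x (j-1)) (x j),
            (uh j 0).eval y = uIl k (x (j-1)) (x j) u0 (P j) (F j) k y 0) →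
        ∀ t ∈ Set.Icc (0:ℝ) T,
          |(1/(2 * Real.pi)) * ∑ j ∈ Finset.Icc 1 N,
              ∫ y in (x (j-1))..(x j), (u0 (y - t) - (uh j t).eval y)|
            ≤ C * (Real.sqrt h + t^2) * h ^ (2*(k:ℝ) + 1/2) * M := by
  obtain ⟨K, hK, hres⟩ := res_bound k hk
  have hpi := Real.pi_pos
  refine ⟨(K + 1) * (2 + Real.sqrt (2 * Real.pi * c)), by positivity, ?_⟩
  intro N x h T hN hx0 hxN hxlt hxh hxc hT u0 hu0 M hM P hP F hF inflow uh hDG hin hinit t ht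
  have hu : ContDiff ℝ ((2 * k + 2 : ℕ) : WithTop ℕ∞) u0 := by exact_mod_cast hu0
  obtain ⟨hdeg, hsm, hdg⟩ := hDG
  have hM0 : 0 ≤ M := (abs_nonneg _).trans (hM 0 (by omega) 0 ⟨by linarith, by linarith⟩)
  have hmem : ∀ m < N, m + 1 ∈ Finset.Icc 1 N := fun m hm => by simp; omega
  have hxmono : ∀ m ≤ N, 0 ≤ x m := by
    intro m
    induction m with
    | zero => intro _; rw [hx0]
    | succ m ih => intro hm; linarith [ih (by omega), hxlt m (by omega)]
  have hxle : ∀ d ≤ N, x (N - d) ≤ 2 * Real.pi := by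
    intro d
    induction d with
    | zero => intro _; simp [hxN]
    | succ d ih =>
      intro hd
      have h1 := hxlt (N - (d + 1)) (by omega)
      rw [show N - (d + 1) + 1 = N - d by omega] at h1
      linarith [ih (by omega)]
  have hxle' : ∀ m ≤ N, x m ≤ 2 * Real.pi := by
    intro m hm
    have := hxle (N - m) (by omega)
    rwa [show N - (N - m) = m by omega] at this
  have hxh' : ∀ m < N, x (m + 1) - x m ≤ h := fun m hm => by simpa using hxh (m + 1) (hmem m hm)
  have hh0 : 0 ≤ h := by linarith [hxh' 0 (by omega), hxlt 0 (by omega)]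
  have hhc : h ≤ 2 * Real.pi * c := by
    have h1 := hxc 1 (hmem 0 (by omega))
    simp only [Nat.sub_self, hx0, sub_zero] at h1
    have h2 := hxle' 1 hN
    nlinarith
  have hF' : ∀ m < N, IsFSeq k (x m) (x (m + 1)) (F (m + 1)) := fun m hm => by
    simpa using hF (m + 1) (hmem m hm)
  have hP' : ∀ m < N, ∀ t, IsGRProj k (x m) (x (m + 1)) (fun y => u0 (y - t)) (P (m + 1) t) :=
    fun m hm => by simpa using hP (m + 1) (hmem m hm)
  set R := K * h ^ (2 * k + 1) * M with hRdef
  have hR0 : 0 ≤ R := by positivity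
  have hR : ∀ m < N, ∀ i ≤ k + 1, ∀ s ∈ Set.Icc 0 T, ∀ y ∈ Set.Icc (x m) (x (m + 1)),
      |((x (m + 1) - x m) / 2) ^ k * Gfun k (x m) (x (m + 1)) u0 i s * (F (m + 1) k).eval y| ≤ R := by
    intro m hm i hi s hs
    apply hres _ _ h (hxlt m hm) (hxh' m hm) u0 hu _ (hF' m hm) i hi M s hM0
    intro j hj y hy
    apply hM j hj
    constructor
    · linarith [hxmono m hm.le, hy.1, hs.2]
    · linarith [hxle' (m + 1) hm, hy.2, hs.1]
  set xi : ℕ → ℝ → Polynomial ℝ := fun m s =>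
    Uc k (x m) (x (m + 1)) u0 (P (m + 1)) (F (m + 1)) s - uh (m + 1) s with hxi
  set E : ℝ → ℝ := fun s => ∑ m ∈ Finset.range N,
    ∫ y in (x m)..(x (m + 1)), (xi m s).eval y * (xi m s).eval y with hEdef
  have hlen : ∑ m ∈ Finset.range N, (x (m + 1) - x m) = 2 * Real.pi := by
    rw [Finset.sum_range_sub, hxN, hx0, sub_zero]
  have hE0 : E 0 = 0 := by
    apply Finset.sum_eq_zero
    intro m hm
    have hm := Finset.mem_range.1 hm
    rw [intervalIntegral.integral_congr (g := fun _ => 0), intervalIntegral.integral_zero]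
    intro y hy
    rw [Set.uIcc_of_le (hxlt m hm).le] at hy
    have h1 := hinit (m + 1) (hmem m hm) y (by simpa using hy)
    simp only [Nat.add_sub_cancel] at h1
    simp only [hxi, Polynomial.eval_sub, Uc_eq_uIl, h1, sub_self, mul_zero]
  have hEd : ∀ s ∈ Set.Icc 0 t, ∃ e' : ℝ, HasDerivAt E e' s ∧
      ∀ lam : ℝ, 0 ≤ lam → lam * e' ≤ lam ^ 2 * (2 * Real.pi * R ^ 2) + E s := by
    intro s hs
    have hsT : s ∈ Set.Icc 0 T := ⟨hs.1, hs.2.trans ht.2⟩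
    set d : ℕ → ℝ := fun m => if m = 0 then 0 else (xi (m - 1) s).eval (x m) with hd
    have hcell : ∀ m ∈ Finset.range N, ∃ e' : ℝ, HasDerivAt (fun s =>
        ∫ y in (x m)..(x (m + 1)), (xi m s).eval y * (xi m s).eval y) e' s ∧
        ∀ lam : ℝ, 0 ≤ lam → lam * e' ≤ lam * (d m ^ 2 - d (m + 1) ^ 2) +
          lam ^ 2 * (R ^ 2 * (x (m + 1) - x m)) +
          ∫ y in (x m)..(x (m + 1)), (xi m s).eval y * (xi m s).eval y := by
      intro m hm
      have hm := Finset.mem_range.1 hm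
      obtain ⟨e', h1, h2⟩ := cell_energy k hk (x m) (x (m + 1)) (hxlt m hm) u0 hu (P (m + 1))
        (hP' m hm) (F (m + 1)) (hF' m hm) (uh (m + 1)) (hdeg _ (hmem m hm)) (hsm _ (hmem m hm)) s
        (if m + 1 = 1 then inflow s else (uh m s).eval (x m)) R
        (fun v hv => by simpa using hdg (m + 1) (hmem m hm) s hsT v hv)
        (hR m hm (k + 1) le_rfl s hsT)
      refine ⟨e', h1, ?_⟩
      have h3 : u0 (x m - s) - (if m + 1 = 1 then inflow s else (uh m s).eval (x m)) = d m := by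
        rcases m with _ | m
        · simp [hd, hx0, hin]
        · have := Uc_right k hk (x m) (x (m + 1)) (hxlt m (by omega)) u0 (P (m + 1))
            (hP' m (by omega)) (F (m + 1)) (hF' m (by omega)) s
          simp [hd, hxi, this]
      have h4 : (Uc k (x m) (x (m + 1)) u0 (P (m + 1)) (F (m + 1)) s - uh (m + 1) s).eval
          (x (m + 1)) = d (m + 1) := by simp [hd, hxi]
      rw [h3, h4] at h2
      exact h2
    choose! e' he' hle using hcell
    refine ⟨∑ m ∈ Finset.range N, e' m, HasDerivAt.fun_sum he', ?_⟩
    intro lam hlam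
    rw [Finset.mul_sum]
    refine (Finset.sum_le_sum fun m hm => hle m hm lam hlam).trans ?_
    rw [Finset.sum_add_distrib, Finset.sum_add_distrib, ← Finset.mul_sum, ← Finset.mul_sum,
      ← Finset.mul_sum, hlen, Finset.sum_range_sub' (fun m => d m ^ 2)]
    have hd0 : d 0 = 0 := by simp [hd]
    rw [hd0]
    have := mul_nonneg hlam (sq_nonneg (d N))
    have hEs : E s = ∑ m ∈ Finset.range N,
      ∫ y in (x m)..(x (m + 1)), (xi m s).eval y * (xi m s).eval y := rfl
    rw [← hEs]
    nlinarith
  have hEt := energy_growth E t (2 * Real.pi * R ^ 2) ht.1 (by positivity) hE0 hEd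
  set A : ℝ := ∑ m ∈ Finset.range N, ∫ y in (x m)..(x (m + 1)), (xi m t).eval y with hA
  have hA2 : ∀ mu : ℝ, 2 * mu * A ≤ E t + mu ^ 2 * (2 * Real.pi) := by
    intro mu
    rw [hA, ← hlen, Finset.mul_sum, Finset.mul_sum, hEdef]
    simp only
    rw [← Finset.sum_add_distrib]
    exact Finset.sum_le_sum fun m hm =>
      mean_le _ _ _ mu (hxlt m (Finset.mem_range.1 hm)).le
  have hAb : |A| ≤ 4 * Real.pi * t * R := by
    apply abs_le_of_sq_le_sq
    · have h1 := hA2 (A / (2 * Real.pi))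
      have h2 : 2 * (A / (2 * Real.pi)) * A = A ^ 2 / Real.pi := by field_simp
      have h3 : (A / (2 * Real.pi)) ^ 2 * (2 * Real.pi) = A ^ 2 / Real.pi / 2 := by field_simp
      rw [h2, h3] at h1
      have h4 : A ^ 2 / Real.pi ≤ 16 * t ^ 2 * Real.pi * R ^ 2 := by linarith
      rw [div_le_iff₀ hpi] at h4
      linarith
    · have := ht.1
      positivity
  have hsplit : ∀ m ∈ Finset.range N, (∫ y in (x m)..(x (m + 1)), (u0 (y - t) - (uh (m + 1) t).eval y))
      = (∫ y in (x m)..(x (m + 1)), ((x (m + 1) - x m) / 2) ^ k * Gfun k (x m) (x (m + 1)) u0 k t *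
          (F (m + 1) k).eval y) + ∫ y in (x m)..(x (m + 1)), (xi m t).eval y := by
    intro m hm
    have hm := Finset.mem_range.1 hm
    have hcu := hu.continuous
    rw [← Uc_mean k hk (x m) (x (m + 1)) (hxlt m hm) u0 hu (P (m + 1)) (hP' m hm) (F (m + 1))
      (hF' m hm) t, ← intervalIntegral.integral_add
        (Continuous.intervalIntegrable (by fun_prop) _ _)
        (Continuous.intervalIntegrable (by fun_prop) _ _)]
    congr 1
    ext y
    simp only [hxi, Polynomial.eval_sub]
    ring
  rw [sum_Icc_one]
  simp only [Nat.add_sub_cancel]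
  rw [Finset.sum_congr rfl hsplit, Finset.sum_add_distrib, ← hA]
  have hB : |∑ m ∈ Finset.range N, ∫ y in (x m)..(x (m + 1)), ((x (m + 1) - x m) / 2) ^ k *
      Gfun k (x m) (x (m + 1)) u0 k t * (F (m + 1) k).eval y| ≤ 2 * Real.pi * R := by
    refine (Finset.abs_sum_le_sum_abs _ _).trans ?_
    rw [← hlen, Finset.sum_mul]
    apply Finset.sum_le_sum
    intro m hm
    have hm := Finset.mem_range.1 hm
    have h1 := intervalIntegral.norm_integral_le_of_norm_le_const (a := x m) (b := x (m + 1))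
      (C := R) (f := fun y => ((x (m + 1) - x m) / 2) ^ k *
      Gfun k (x m) (x (m + 1)) u0 k t * (F (m + 1) k).eval y) (fun y hy => by
        rw [Set.uIoc_of_le (hxlt m hm).le] at hy
        exact hR m hm k (by omega) t ht y ⟨hy.1.le, hy.2⟩)
    rw [abs_of_pos (sub_pos.2 (hxlt m hm)), Real.norm_eq_abs] at h1
    linarith
  refine le_trans ?_ (final_bound k K h c t M hK hh0 hhc ht.1 hM0)
  rw [← hRdef, abs_mul, abs_of_pos (by positivity)]
  rw [one_div, inv_mul_le_iff₀ (by positivity)]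
  refine (abs_add_le _ _).trans ?_
  linarith
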